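/- arXiv:2103.08770 — 3 statements merged into one kernel-verified Lean document; each statement's English description precedes it below -/
import Mathlib

section
/- Let d ≥ 1, let 2 ≤ r < ∞, and assume additionally r < 2d/(d-2) when d ≥ 3. Set θ = d(r-2)/(2r). There exists a constant C = C(d,r) > 0 such that for every real t ≠ 0 and every Schwartz function u : ℝ^d → ℂ, ‖u‖_{L^r(ℝ^d)} ≤ C |t|^{-θ} ‖u‖_{L²(ℝ^d)}^{1-θ} ‖J(t)u‖_{L²(ℝ^d)}^{θ}. -/
open MeasureTheory Complex
open scoped ENNReal NNReal

noncomputable section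
/-- The Galilean vector field `J(t)u(x) = x u(x) + 2it ∇u(x)`, as a `ℂ^d`-valued function. -/
def Jfield (d : ℕ) (t : ℝ) (u : EuclideanSpace ℝ (Fin d) → ℂ)
    (x : EuclideanSpace ℝ (Fin d)) : EuclideanSpace ℂ (Fin d) :=
  (WithLp.equiv 2 (Fin d → ℂ)).symm
    (fun j => (x j : ℂ) * u x +
      2 * Complex.I * (t : ℂ) * fderiv ℝ u x (EuclideanSpace.single j 1))

theorem gn_eLpNorm_rpow {E F : Type*} [MeasurableSpace E] {μ : Measure E} [NormedAddCommGroup F]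
    (f : E → F) {s : ℝ} (hs : 0 < s) :
    eLpNorm f (ENNReal.ofReal s) μ = (∫⁻ x, ‖f x‖ₑ ^ s ∂μ) ^ (1 / s) := by
  rw [eLpNorm_eq_lintegral_rpow_enorm_toReal (by simpa using hs) ENNReal.ofReal_ne_top,
    ENNReal.toReal_ofReal hs.le]

theorem gn_eLpNorm_two {E F : Type*} [MeasurableSpace E] {μ : Measure E} [NormedAddCommGroup F]
    (f : E → F) :
    eLpNorm f 2 μ = (∫⁻ x, ‖f x‖ₑ ^ (2:ℝ) ∂μ) ^ (1 / (2:ℝ)) := by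
  have := gn_eLpNorm_rpow (μ := μ) f (s := 2) (by norm_num)
  simpa using this

theorem gn_interp {E F : Type*} [MeasurableSpace E] {μ : Measure E} [NormedAddCommGroup F]
    (f : E → F) (hf : AEStronglyMeasurable f μ) {r q l : ℝ} (hr : 0 < r) (hq : 0 < q)
    (hl0 : 0 ≤ l) (hl1 : l ≤ 1) (h : 1 / r = (1 - l) / 2 + l / q) :
    eLpNorm f (ENNReal.ofReal r) μ ≤
      eLpNorm f 2 μ ^ (1 - l) * eLpNorm f (ENNReal.ofReal q) μ ^ l := by
  rw [gn_eLpNorm_rpow f hr, gn_eLpNorm_rpow f hq, gn_eLpNorm_two]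
  have h1 : r * ((1 - l) / 2) + r * (l / q) = 1 := by
    rw [← mul_add, ← h]; field_simp
  have key := ENNReal.lintegral_mul_norm_pow_le (μ := μ) (f := fun x => ‖f x‖ₑ ^ (2:ℝ))
    (g := fun x => ‖f x‖ₑ ^ q) (hf.enorm.pow_const _) (hf.enorm.pow_const _)
    (p := r * ((1 - l) / 2)) (q := r * (l / q)) (mul_nonneg hr.le (div_nonneg (by linarith) (by norm_num)))
    (by positivity) h1
  have e : ∀ x, (‖f x‖ₑ ^ (2:ℝ)) ^ (r * ((1 - l) / 2)) * (‖f x‖ₑ ^ q) ^ (r * (l / q))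
      = ‖f x‖ₑ ^ r := by
    intro x
    rw [← ENNReal.rpow_mul, ← ENNReal.rpow_mul, ← ENNReal.rpow_add_of_nonneg]
    · congr 1; field_simp; ring
    · have : 0 ≤ 1 - l := by linarith
      positivity
    · positivity
  simp only [e] at key
  refine (ENNReal.rpow_le_rpow key (by positivity : 0 ≤ 1 / r)).trans (le_of_eq ?_)
  rw [ENNReal.mul_rpow_of_nonneg _ _ (by positivity), ← ENNReal.rpow_mul, ← ENNReal.rpow_mul,
    ← ENNReal.rpow_mul, ← ENNReal.rpow_mul]
  congr 2
  · field_simp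
  · field_simp

theorem gn_combine {A D B X : ℝ≥0∞} {C : ℝ≥0} {l s : ℝ} (hl0 : 0 ≤ l) (hl1 : l ≤ 1)
    (hs1 : s ≤ 1)
    (hX : X ≤ A ^ (1 - l) * B ^ l) (hB : B ≤ C * A ^ (1 - s) * D ^ s) :
    X ≤ ((C ^ l : ℝ≥0) : ℝ≥0∞) * A ^ (1 - l * s) * D ^ (l * s) := by
  refine hX.trans ((mul_le_mul_right (ENNReal.rpow_le_rpow hB hl0) _).trans (le_of_eq ?_))
  rw [ENNReal.mul_rpow_of_nonneg _ _ hl0, ENNReal.mul_rpow_of_nonneg _ _ hl0,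
    ← ENNReal.rpow_mul, ← ENNReal.rpow_mul, ENNReal.coe_rpow_of_nonneg _ hl0,
    show 1 - l * s = (1 - l) + (1 - s) * l by ring, ENNReal.rpow_add_of_nonneg _ _ (by linarith)
      (mul_nonneg (by linarith) hl0), mul_comm s l]
  ring

/-- Derivative of a power of a complex function. -/
theorem gn_fderiv_pow {E : Type*} [NormedAddCommGroup E] [NormedSpace ℝ E] {v : E → ℂ}
    (hv : ContDiff ℝ 1 v) (k : ℕ) (x : E) :
    ‖fderiv ℝ (fun y => v y ^ (k + 1)) x‖ₑ ≤ (k + 1 : ℕ) * (‖v x‖ₑ ^ k * ‖fderiv ℝ v x‖ₑ) := by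
  have h := ((hv.differentiable one_ne_zero x).hasFDerivAt.pow (k + 1)).fderiv
  rw [h]
  simp only [Nat.add_sub_cancel, enorm_smul]
  rw [← mul_assoc, ← enorm_pow, nsmul_eq_mul, enorm_mul]
  gcongr
  rw [enorm_eq_nnnorm, Complex.nnnorm_natCast]
  simp

/-- Dimension one: pointwise bound. -/
theorem gn_one_pointwise {v : EuclideanSpace ℝ (Fin 1) → ℂ} (hv : ContDiff ℝ 1 v)
    (hc : HasCompactSupport v) (x : EuclideanSpace ℝ (Fin 1)) :
    ‖v x‖ₑ ≤ ∫⁻ y, ‖fderiv ℝ v y‖ₑ := by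
  let e : ℝ ≃ₗᵢ[ℝ] EuclideanSpace ℝ (Fin 1) := (OrthonormalBasis.singleton (Fin 1) ℝ).repr
  have h1 := HasCompactSupport.enorm_le_lintegral_Ici_deriv (f := v ∘ e)
    (hv.comp e.contDiff) (hc.comp_homeomorph e.toHomeomorph) (e.symm x)
  have h2 : ∀ y, ‖deriv (v ∘ e) y‖ₑ ≤ ‖fderiv ℝ v (e y)‖ₑ := by
    intro y
    have hd : HasDerivAt (v ∘ e) (fderiv ℝ v (e y) (e 1)) y := by
      have h0 : HasDerivAt (fun z => e z) (e 1) y := by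
        simpa using (e.toContinuousLinearEquiv.toContinuousLinearMap.hasDerivAt (x := y))
      exact (hv.differentiable one_ne_zero (e y)).hasFDerivAt.comp_hasDerivAt y h0
    rw [hd.deriv]
    refine (ContinuousLinearMap.le_opENorm _ _).trans ?_
    simp
  have h3 := e.measurePreserving.lintegral_comp_emb e.toHomeomorph.measurableEmbedding
    (fun z => ‖fderiv ℝ v z‖ₑ)
  rw [← h3]
  simp only [Function.comp_apply, LinearIsometryEquiv.apply_symm_apply] at h1
  refine h1.trans ((setLIntegral_le_lintegral _ _).trans (lintegral_mono h2))

/-- Cauchy-Schwarz for lower integrals. -/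
theorem gn_cs {E : Type*} [MeasurableSpace E] {μ : Measure E} {f g : E → ℝ≥0∞}
    (hf : AEMeasurable f μ) (hg : AEMeasurable g μ) :
    (∫⁻ x, f x * g x ∂μ) ^ 2 ≤ (∫⁻ x, f x ^ 2 ∂μ) * ∫⁻ x, g x ^ 2 ∂μ := by
  have h := ENNReal.lintegral_mul_le_Lp_mul_Lq μ (p := 2) (q := 2) Real.HolderConjugate.two_two hf hg
  have h2 : (∫⁻ x, f x * g x ∂μ) ^ 2 ≤ _ := pow_le_pow_left' h 2
  refine h2.trans (le_of_eq ?_)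
  rw [mul_pow]
  simp only [← ENNReal.rpow_natCast, ← ENNReal.rpow_mul]
  norm_num

theorem gn_two_step {v : EuclideanSpace ℝ (Fin 2) → ℂ} (hv : ContDiff ℝ 1 v)
    (hc : HasCompactSupport v) (k : ℕ) :
    ∫⁻ x, ‖v x‖ₑ ^ (2 * (k + 1)) ≤
      (lintegralPowLePowLIntegralFDerivConst (volume : Measure (EuclideanSpace ℝ (Fin 2))) 2 *
        (k + 1 : ℕ) ^ 2 : ℝ≥0) * ((∫⁻ x, ‖v x‖ₑ ^ (2 * k)) * ∫⁻ x, ‖fderiv ℝ v x‖ₑ ^ 2) := by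
  have hcc : HasCompactSupport (fun y => v y ^ (k + 1)) :=
    hc.comp_left (g := fun z : ℂ => z ^ (k + 1)) (by simp)
  have h := lintegral_pow_le_pow_lintegral_fderiv (volume : Measure (EuclideanSpace ℝ (Fin 2)))
    (u := fun y => v y ^ (k + 1)) (hv.pow _) hcc (p := 2)
    (by simpa using Real.HolderConjugate.two_two)
  have e1 : ∀ x, ‖v x ^ (k + 1)‖ₑ ^ (2:ℝ) = ‖v x‖ₑ ^ (2 * (k + 1)) := by
    intro x
    rw [enorm_pow, show (2:ℝ) = ((2:ℕ):ℝ) by norm_num, ENNReal.rpow_natCast, ← pow_mul, mul_comm]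
  simp only [e1] at h
  refine h.trans ?_
  rw [show (2:ℝ) = ((2:ℕ):ℝ) by norm_num, ENNReal.rpow_natCast]
  push_cast
  rw [mul_assoc]
  gcongr
  calc (∫⁻ x, ‖fderiv ℝ (fun y => v y ^ (k + 1)) x‖ₑ) ^ 2
      ≤ (∫⁻ x, (k + 1 : ℕ) * (‖v x‖ₑ ^ k * ‖fderiv ℝ v x‖ₑ)) ^ 2 := by
        gcongr with x
        exact gn_fderiv_pow hv k x
    _ = (k + 1 : ℕ) ^ 2 * (∫⁻ x, ‖v x‖ₑ ^ k * ‖fderiv ℝ v x‖ₑ) ^ 2 := by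
        rw [lintegral_const_mul' _ _ (by simp), mul_pow]
    _ ≤ (k + 1 : ℕ) ^ 2 * ((∫⁻ x, (‖v x‖ₑ ^ k) ^ 2) * ∫⁻ x, ‖fderiv ℝ v x‖ₑ ^ 2) := by
        gcongr
        apply gn_cs
        · exact hv.continuous.enorm.aemeasurable.pow_const k
        · exact (hv.continuous_fderiv one_ne_zero).enorm.aemeasurable
    _ = _ := by
        simp only [← pow_mul, mul_comm k 2]
        push_cast
        ring

theorem gn_two (k : ℕ) : ∃ C : ℝ≥0, ∀ v : EuclideanSpace ℝ (Fin 2) → ℂ, ContDiff ℝ 1 v →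
    HasCompactSupport v →
    ∫⁻ x, ‖v x‖ₑ ^ (2 * (k + 1)) ≤
      C * (∫⁻ x, ‖v x‖ₑ ^ 2) * (∫⁻ x, ‖fderiv ℝ v x‖ₑ ^ 2) ^ k := by
  induction k with
  | zero => exact ⟨1, fun v _ _ => by simp⟩
  | succ k ih =>
    obtain ⟨C, hC⟩ := ih
    refine ⟨lintegralPowLePowLIntegralFDerivConst
      (volume : Measure (EuclideanSpace ℝ (Fin 2))) 2 * (k + 1 + 1 : ℕ) ^ 2 * C, fun v hv hc => (gn_two_step hv hc (k + 1)).trans ?_⟩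
    refine (mul_le_mul_right (mul_le_mul_left (hC v hv hc) _) _).trans (le_of_eq ?_)
    push_cast
    ring

/-- Interpolation between `L²` and an endpoint estimate. -/
theorem gn_of_endpoint (d : ℕ) (r q s : ℝ) (hr : 2 ≤ r) (hrq : r ≤ q) (hq : 2 < q)
    (hs1 : s ≤ 1) (hs : s = d * (q - 2) / (2 * q))
    (h : ∃ C : ℝ≥0, ∀ v : EuclideanSpace ℝ (Fin d) → ℂ, ContDiff ℝ 1 v → HasCompactSupport v →
      eLpNorm v (ENNReal.ofReal q) volume ≤
        C * eLpNorm v 2 volume ^ (1 - s) * eLpNorm (fderiv ℝ v) 2 volume ^ s) :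
    ∃ C : ℝ≥0, ∀ v : EuclideanSpace ℝ (Fin d) → ℂ, ContDiff ℝ 1 v → HasCompactSupport v →
      eLpNorm v (ENNReal.ofReal r) volume ≤
        C * eLpNorm v 2 volume ^ (1 - (d : ℝ) * (r - 2) / (2 * r)) *
          eLpNorm (fderiv ℝ v) 2 volume ^ ((d : ℝ) * (r - 2) / (2 * r)) := by
  obtain ⟨C, hC⟩ := h
  have hq2 : 0 < q - 2 := by linarith
  have hr0 : 0 < r := by linarith
  have hq0 : 0 < q := by linarith
  set l : ℝ := ((r - 2) * q) / (r * (q - 2)) with hl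
  have hl0 : 0 ≤ l := div_nonneg (mul_nonneg (by linarith) hq0.le) (by positivity)
  have hl1 : l ≤ 1 := by
    rw [hl, div_le_one (by positivity)]
    nlinarith
  have hls : (d : ℝ) * (r - 2) / (2 * r) = l * s := by
    rw [hs, hl]; field_simp
  refine ⟨C ^ l, fun v hv hc => ?_⟩
  rw [hls]
  refine gn_combine hl0 hl1 hs1 (gn_interp v hv.continuous.aestronglyMeasurable hr0 hq0 hl0 hl1 ?_)
    (hC v hv hc)
  rw [hl]; field_simp; ring

theorem gn_compact_one (r : ℝ) (hr : 2 ≤ r) :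
    ∃ C : ℝ≥0, ∀ v : EuclideanSpace ℝ (Fin 1) → ℂ, ContDiff ℝ 1 v → HasCompactSupport v →
      eLpNorm v (ENNReal.ofReal r) volume ≤
        C * eLpNorm v 2 volume ^ (1 - ((1 : ℕ) : ℝ) * (r - 2) / (2 * r)) *
          eLpNorm (fderiv ℝ v) 2 volume ^ (((1 : ℕ) : ℝ) * (r - 2) / (2 * r)) := by
  have hr0 : 0 < r := by linarith
  set s : ℝ := ((1 : ℕ) : ℝ) * (r - 2) / (2 * r) with hs
  have hs0 : 0 ≤ s := div_nonneg (mul_nonneg (by norm_num) (by linarith)) (by positivity)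
  refine ⟨2 ^ s, fun v hv hc => ?_⟩
  set A := eLpNorm v 2 volume with hA
  set D := eLpNorm (fderiv ℝ v) 2 volume with hD
  have hA2 : A ^ (2:ℝ) = ∫⁻ x, ‖v x‖ₑ ^ (2:ℝ) := by
    rw [hA, gn_eLpNorm_two, ← ENNReal.rpow_mul]; norm_num
  have hD2 : D ^ (2:ℝ) = ∫⁻ x, ‖fderiv ℝ v x‖ₑ ^ (2:ℝ) := by
    rw [hD, gn_eLpNorm_two, ← ENNReal.rpow_mul]; norm_num
  have hcc : HasCompactSupport (fun y => v y ^ (1 + 1)) :=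
    hc.comp_left (g := fun z : ℂ => z ^ (1 + 1)) (by simp)
  have hpt : ∀ x, ‖v x‖ₑ ^ (2:ℝ) ≤ 2 * (A * D) := by
    intro x
    have h := gn_one_pointwise (hv.pow (1 + 1)) hcc x
    have h' : (∫⁻ x, ‖v x‖ₑ * ‖fderiv ℝ v x‖ₑ) ≤ A * D := by
      have := ENNReal.lintegral_mul_le_Lp_mul_Lq (volume : Measure (EuclideanSpace ℝ (Fin 1)))
        (p := 2) (q := 2) Real.HolderConjugate.two_two
        (f := fun x => ‖v x‖ₑ) (g := fun x => ‖fderiv ℝ v x‖ₑ)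
        hv.continuous.enorm.aemeasurable (hv.continuous_fderiv one_ne_zero).enorm.aemeasurable
      rw [hA, hD, gn_eLpNorm_two, gn_eLpNorm_two]
      exact this
    calc ‖v x‖ₑ ^ (2:ℝ) = ‖v x ^ (1 + 1)‖ₑ := by
          rw [enorm_pow, ← ENNReal.rpow_natCast]; norm_num
      _ ≤ ∫⁻ y, ‖fderiv ℝ (fun y => v y ^ (1 + 1)) y‖ₑ := h
      _ ≤ ∫⁻ y, 2 * (‖v y‖ₑ * ‖fderiv ℝ v y‖ₑ) := by
          refine lintegral_mono fun y => (gn_fderiv_pow hv 1 y).trans (le_of_eq ?_)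
          norm_num
      _ = 2 * ∫⁻ y, (‖v y‖ₑ * ‖fderiv ℝ v y‖ₑ) := lintegral_const_mul' _ _ (by simp)
      _ ≤ _ := by gcongr
  have hint : ∫⁻ x, ‖v x‖ₑ ^ r ≤ (2 * (A * D)) ^ ((r - 2) / 2) * A ^ (2:ℝ) := by
    rw [hA2]
    have hm : Measurable (fun x => ‖v x‖ₑ ^ (2:ℝ)) := hv.continuous.enorm.measurable.pow_const _
    rw [← lintegral_const_mul _ hm]
    refine lintegral_mono fun x => ?_
    calc ‖v x‖ₑ ^ r = (‖v x‖ₑ ^ (2:ℝ)) ^ ((r - 2) / 2) * ‖v x‖ₑ ^ (2:ℝ) := by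
          rw [← ENNReal.rpow_mul, ← ENNReal.rpow_add_of_nonneg _ _ (by linarith) (by norm_num)]
          congr 1; ring
      _ ≤ _ := by
          gcongr
          exact hpt x
  rw [gn_eLpNorm_rpow v hr0]
  refine (ENNReal.rpow_le_rpow hint (by positivity)).trans (le_of_eq ?_)
  have e1 : (r - 2) / 2 * (1 / r) = s := by rw [hs]; push_cast; field_simp
  rw [ENNReal.mul_rpow_of_nonneg _ _ (by positivity), ← ENNReal.rpow_mul, ← ENNReal.rpow_mul, e1,
    ENNReal.mul_rpow_of_nonneg _ _ hs0, ENNReal.mul_rpow_of_nonneg _ _ hs0,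
    show 1 - s = s + 2 * (1 / r) by rw [hs]; push_cast; field_simp; ring,
    ENNReal.rpow_add_of_nonneg _ _ hs0 (by positivity), ENNReal.coe_rpow_of_nonneg _ hs0]
  push_cast
  ring

theorem gn_compact_two (r : ℝ) (hr : 2 ≤ r) :
    ∃ C : ℝ≥0, ∀ v : EuclideanSpace ℝ (Fin 2) → ℂ, ContDiff ℝ 1 v → HasCompactSupport v →
      eLpNorm v (ENNReal.ofReal r) volume ≤
        C * eLpNorm v 2 volume ^ (1 - ((2 : ℕ) : ℝ) * (r - 2) / (2 * r)) *
          eLpNorm (fderiv ℝ v) 2 volume ^ (((2 : ℕ) : ℝ) * (r - 2) / (2 * r)) := by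
  obtain ⟨k, hk⟩ := exists_nat_gt r
  have hk0 : (0:ℝ) < k := by linarith
  refine gn_of_endpoint 2 r (2 * (k + 1)) (k / (k + 1)) hr (by linarith) (by linarith)
    (by rw [div_le_one (by positivity)]; linarith) (by push_cast; field_simp; ring) ?_
  obtain ⟨C, hC⟩ := gn_two k
  refine ⟨C ^ (1 / (2 * ((k:ℝ) + 1))), fun v hv hc => ?_⟩
  have h := hC v hv hc
  rw [gn_eLpNorm_rpow v (by positivity), gn_eLpNorm_two, gn_eLpNorm_two]
  have e1 : ∀ x, ‖v x‖ₑ ^ (2 * ((k:ℝ) + 1)) = ‖v x‖ₑ ^ (2 * (k + 1)) := by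
    intro x
    rw [← ENNReal.rpow_natCast]; push_cast; rfl
  have e2 : ∀ a : ℝ≥0∞, a ^ (2:ℝ) = a ^ 2 := fun a => by
    rw [← ENNReal.rpow_natCast]; norm_num
  simp only [e1, e2]
  refine (ENNReal.rpow_le_rpow h (by positivity)).trans (le_of_eq ?_)
  rw [ENNReal.mul_rpow_of_nonneg _ _ (by positivity), ENNReal.mul_rpow_of_nonneg _ _ (by positivity),
    ← ENNReal.rpow_natCast, ← ENNReal.rpow_mul, ← ENNReal.rpow_mul, ← ENNReal.rpow_mul,
    ENNReal.coe_rpow_of_nonneg _ (by positivity)]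
  congr 2
  · congr 2
    field_simp; ring
  · field_simp

theorem gn_compact (d : ℕ) (hd : 1 ≤ d) (r : ℝ) (hr2 : 2 ≤ r)
    (hrd : 3 ≤ d → r < 2 * d / (d - 2)) :
    ∃ C : ℝ≥0, ∀ v : EuclideanSpace ℝ (Fin d) → ℂ, ContDiff ℝ 1 v → HasCompactSupport v →
      eLpNorm v (ENNReal.ofReal r) volume ≤
        C * eLpNorm v 2 volume ^ (1 - (d : ℝ) * (r - 2) / (2 * r)) *
          eLpNorm (fderiv ℝ v) 2 volume ^ ((d : ℝ) * (r - 2) / (2 * r)) := by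
  rcases Nat.lt_or_ge d 3 with h3 | h3
  · interval_cases d
    · exact gn_compact_one r hr2
    · exact gn_compact_two r hr2
  have hd3 : (3:ℝ) ≤ d := by exact_mod_cast h3
  have hd2 : (0:ℝ) < d - 2 := by linarith
  have hq : (2:ℝ) < 2 * d / (d - 2) := by rw [lt_div_iff₀ hd2]; linarith
  refine gn_of_endpoint d r (2 * d / (d - 2)) 1 hr2 (hrd h3).le hq le_rfl
    (by field_simp; ring) ?_
  refine ⟨SNormLESNormFDerivOfEqConst ℂ (volume : Measure (EuclideanSpace ℝ (Fin d))) (2:ℝ≥0),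
    fun v hv hc => ?_⟩
  have := eLpNorm_le_eLpNorm_fderiv_of_eq (volume : Measure (EuclideanSpace ℝ (Fin d)))
    hv hc (p := 2) (p' := (2 * d / (d - 2) : ℝ).toNNReal) (by norm_num) (by simp; omega)
    (by
      rw [Real.coe_toNNReal _ (by linarith)]
      simp
      field_simp)
  simpa [ENNReal.ofReal] using this

/-- A sequence of cutoffs with the needed bounds. -/
theorem gn_cutoff (d : ℕ) : ∃ (K : ℝ≥0) (χ : ℕ → EuclideanSpace ℝ (Fin d) → ℝ),
    (∀ n, ContDiff ℝ 1 (χ n)) ∧ (∀ n, HasCompactSupport (χ n)) ∧ (∀ n x, ‖χ n x‖ₑ ≤ 1) ∧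
    (∀ n x, ‖fderiv ℝ (χ n) x‖ₑ ≤ K * ((n : ℝ≥0∞) + 1)⁻¹) ∧
    (∀ x, Filter.Tendsto (fun n => χ n x) Filter.atTop (nhds 1)) := by
  let f : ContDiffBump (0 : EuclideanSpace ℝ (Fin d)) := ⟨1, 2, by norm_num, by norm_num⟩
  have hf1 : ContDiff ℝ 1 f := f.contDiff
  obtain ⟨K, hK⟩ := (hf1.continuous_fderiv one_ne_zero).bounded_above_of_compact_support
    (f.hasCompactSupport.fderiv (𝕜 := ℝ))
  have hpos : ∀ n : ℕ, (0:ℝ) < ((n:ℝ) + 1)⁻¹ := fun n => by positivity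
  refine ⟨K.toNNReal, fun n x => f ((((n:ℝ) + 1)⁻¹) • x), fun n => ?_, fun n => ?_, fun n x => ?_,
    fun n x => ?_, fun x => ?_⟩
  · exact hf1.comp (contDiff_const_smul _)
  · exact f.hasCompactSupport.comp_smul (hpos n).ne'
  · have h1 := f.le_one (x := (((n:ℝ) + 1)⁻¹) • x)
    have h0 := f.nonneg (x := (((n:ℝ) + 1)⁻¹) • x)
    rw [Real.enorm_of_nonneg h0]
    simpa using h1
  · have hd : HasFDerivAt (fun x => f ((((n:ℝ) + 1)⁻¹) • x))
        ((((n:ℝ) + 1)⁻¹) • fderiv ℝ f ((((n:ℝ) + 1)⁻¹) • x)) x := by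
      have h1 := (hf1.differentiable one_ne_zero ((((n:ℝ) + 1)⁻¹) • x)).hasFDerivAt.comp x
        ((hasFDerivAt_id (𝕜 := ℝ) x).const_smul (((n:ℝ) + 1)⁻¹))
      refine h1.congr_fderiv ?_
      ext y
      simp
    rw [hd.fderiv, enorm_smul, mul_comm]
    gcongr
    · rw [← ofReal_norm]
      exact ENNReal.ofReal_le_ofReal (hK _)
    · rw [Real.enorm_of_nonneg (hpos n).le, ENNReal.ofReal_inv_of_pos (by positivity),
        ENNReal.ofReal_add (by positivity) (by norm_num)]
      simp
  · have h1 : Filter.Tendsto (fun n : ℕ => ((n:ℝ) + 1)⁻¹ • x) Filter.atTop (nhds 0) := by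
      have := (tendsto_one_div_add_atTop_nhds_zero_nat (𝕜 := ℝ)).smul_const x
      simpa using this
    have h2 := (hf1.continuous.tendsto 0).comp h1
    have h3 : f 0 = 1 := f.one_of_mem_closedBall (by simp [f])
    rw [h3] at h2
    exact h2

theorem gn_general (d : ℕ) (hd : 1 ≤ d) (r : ℝ) (hr2 : 2 ≤ r)
    (hrd : 3 ≤ d → r < 2 * d / (d - 2)) :
    ∃ C : ℝ≥0, ∀ v : EuclideanSpace ℝ (Fin d) → ℂ, ContDiff ℝ 1 v → eLpNorm v 2 volume ≠ ∞ →
      eLpNorm v (ENNReal.ofReal r) volume ≤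
        C * eLpNorm v 2 volume ^ (1 - (d : ℝ) * (r - 2) / (2 * r)) *
          eLpNorm (fderiv ℝ v) 2 volume ^ ((d : ℝ) * (r - 2) / (2 * r)) := by
  obtain ⟨C, hC⟩ := gn_compact d hd r hr2 hrd
  obtain ⟨K, χ, h1, h2, h3, h4, h5⟩ := gn_cutoff d
  refine ⟨C, fun v hv hfin => ?_⟩
  have hr0 : 0 < r := by linarith
  set s : ℝ := (d : ℝ) * (r - 2) / (2 * r) with hs
  have hs0 : 0 ≤ s := div_nonneg (mul_nonneg (by positivity) (by linarith)) (by positivity)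
  have hs1 : s ≤ 1 := by
    rw [hs, div_le_one (by positivity)]
    rcases Nat.lt_or_ge d 3 with h | h
    · have : (d:ℝ) ≤ 2 := by exact_mod_cast Nat.le_of_lt_succ h
      nlinarith
    · have hd3 : (3:ℝ) ≤ d := by exact_mod_cast h
      have := hrd h
      rw [lt_div_iff₀ (by linarith)] at this
      nlinarith
  set A := eLpNorm v 2 volume with hA
  set D := eLpNorm (fderiv ℝ v) 2 volume with hD
  have hw1 : ∀ n, ContDiff ℝ 1 (fun x => χ n x • v x) := fun n => (h1 n).smul hv
  have hw2 : ∀ n, HasCompactSupport (fun x => χ n x • v x) := fun n => (h2 n).smul_right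
  have hwA : ∀ n, eLpNorm (fun x => χ n x • v x) 2 volume ≤ A := fun n => by
    refine eLpNorm_mono_enorm fun x => ?_
    rw [enorm_smul]
    exact (mul_le_mul_left (h3 n x) _).trans (by simp)
  have hwD : ∀ n : ℕ, eLpNorm (fderiv ℝ (fun x => χ n x • v x)) 2 volume ≤
      D + (K * ((n : ℝ≥0∞) + 1)⁻¹) * A := fun n => by
    have e : fderiv ℝ (fun x => χ n x • v x) =
        (fun x => χ n x • fderiv ℝ v x) + fun x => (fderiv ℝ (χ n) x).smulRight (v x) := by
      funext x
      exact fderiv_fun_smul ((h1 n).differentiable one_ne_zero x) (hv.differentiable one_ne_zero x)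
    have m1 : Continuous (fun x => χ n x • fderiv ℝ v x) :=
      (h1 n).continuous.smul (hv.continuous_fderiv one_ne_zero)
    have m2 : Continuous (fun x => (fderiv ℝ (χ n) x).smulRight (v x)) := by
      have := ((hw1 n).continuous_fderiv one_ne_zero).sub m1
      rw [e] at this
      refine this.congr fun x => ?_
      simp
    rw [e]
    refine (eLpNorm_add_le m1.aestronglyMeasurable m2.aestronglyMeasurable (by norm_num)).trans ?_
    refine add_le_add ?_ ?_
    · refine eLpNorm_mono_enorm fun x => ?_
      rw [enorm_smul]
      exact (mul_le_mul_left (h3 n x) _).trans (by simp)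
    · have hk : (K * ((n : ℝ≥0∞) + 1)⁻¹) ≠ ∞ := ENNReal.mul_ne_top (by simp) (by simp)
      have := eLpNorm_le_nnreal_smul_eLpNorm_of_ae_le_mul (μ := volume)
        (f := fun x => (fderiv ℝ (χ n) x).smulRight (v x)) (g := v)
        (c := (K * ((n : ℝ≥0∞) + 1)⁻¹).toNNReal) (Filter.Eventually.of_forall fun x => ?_) 2
      · refine this.trans (le_of_eq ?_)
        rw [ENNReal.smul_def, ENNReal.coe_toNNReal hk, smul_eq_mul]
      · rw [← ENNReal.coe_le_coe, ENNReal.coe_mul, ENNReal.coe_toNNReal hk]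
        have e2 : ‖(fderiv ℝ (χ n) x).smulRight (v x)‖ₑ = ‖fderiv ℝ (χ n) x‖ₑ * ‖v x‖ₑ := by
          simp only [enorm_eq_nnnorm, ← ENNReal.coe_mul]
          congr 1
          ext
          simp
        have e3 := mul_le_mul_left (h4 n x) ‖v x‖ₑ
        rw [← e2] at e3
        exact e3
  have hlim := Lp.eLpNorm_lim_le_liminf_eLpNorm (p := ENNReal.ofReal r) (μ := volume)
    (f := fun n x => χ n x • v x) (fun n => (hw1 n).continuous.aestronglyMeasurable) v
    (Filter.Eventually.of_forall fun x => by
      have := (h5 x).smul_const (v x)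
      simpa using this)
  refine hlim.trans ?_
  have hb : ∀ n : ℕ, eLpNorm (fun x => χ n x • v x) (ENNReal.ofReal r) volume ≤
      C * A ^ (1 - s) * (D + (K * ((n : ℝ≥0∞) + 1)⁻¹) * A) ^ s := fun n => by
    refine (hC _ (hw1 n) (hw2 n)).trans ?_
    exact mul_le_mul' (mul_le_mul_right (ENNReal.rpow_le_rpow (hwA n) (by linarith)) _)
      (ENNReal.rpow_le_rpow (hwD n) hs0)
  refine (Filter.liminf_le_liminf (Filter.Eventually.of_forall hb)).trans (le_of_eq ?_)
  refine Filter.Tendsto.liminf_eq ?_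
  refine ENNReal.Tendsto.const_mul ?_ (Or.inr (ENNReal.mul_ne_top (by simp)
    (ENNReal.rpow_ne_top_of_nonneg (by linarith) hfin)))
  refine (ENNReal.continuous_rpow_const.tendsto D).comp ?_
  have t0 : Filter.Tendsto (fun n : ℕ => ((n : ℝ≥0∞) + 1)⁻¹) Filter.atTop (nhds 0) := by
    have := (Filter.tendsto_add_atTop_iff_nat 1).2 ENNReal.tendsto_inv_nat_nhds_zero
    simpa using this
  have t1 := ENNReal.Tendsto.mul_const (b := A) (ENNReal.Tendsto.const_mul (a := (K:ℝ≥0∞)) t0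
    (Or.inr (by simp))) (Or.inr hfin)
  have t2 := t1.const_add D
  simpa using t2

/-- The phase-twisted function. -/
def gnTwist (d : ℕ) (t : ℝ) (u : EuclideanSpace ℝ (Fin d) → ℂ) (x : EuclideanSpace ℝ (Fin d)) : ℂ :=
  Complex.exp (((-(‖x‖ ^ 2 / (4 * t)) : ℝ) : ℂ) * Complex.I) * u x

theorem gnTwist_norm (d : ℕ) (t : ℝ) (u : EuclideanSpace ℝ (Fin d) → ℂ)
    (x : EuclideanSpace ℝ (Fin d)) : ‖gnTwist d t u x‖ = ‖u x‖ := by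
  rw [gnTwist, norm_mul, Complex.norm_exp_ofReal_mul_I, one_mul]

theorem gnTwist_contDiff (d : ℕ) (t : ℝ) (u : EuclideanSpace ℝ (Fin d) → ℂ)
    (hu : ContDiff ℝ 1 u) : ContDiff ℝ 1 (gnTwist d t u) := by
  unfold gnTwist
  have h1 : ContDiff ℝ 1 (fun x : EuclideanSpace ℝ (Fin d) => -(‖x‖ ^ 2 / (4 * t))) :=
    ((contDiff_norm_sq ℝ).div_const _).neg
  have h2 : ContDiff ℝ 1 (fun x : EuclideanSpace ℝ (Fin d) =>
      ((-(‖x‖ ^ 2 / (4 * t)) : ℝ) : ℂ)) := Complex.ofRealCLM.contDiff.comp h1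
  exact ((h2.mul contDiff_const).cexp).mul hu

theorem gnTwist_fderiv (d : ℕ) (t : ℝ) (ht : t ≠ 0) (u : EuclideanSpace ℝ (Fin d) → ℂ)
    (hu : ContDiff ℝ 1 u) (x h : EuclideanSpace ℝ (Fin d)) :
    2 * Complex.I * t * fderiv ℝ (gnTwist d t u) x h =
      Complex.exp (((-(‖x‖ ^ 2 / (4 * t)) : ℝ) : ℂ) * Complex.I) *
        ((inner ℝ x h : ℝ) * u x + 2 * Complex.I * t * fderiv ℝ u x h) := by
  have h1 : HasFDerivAt (fun x : EuclideanSpace ℝ (Fin d) => ‖x‖ ^ 2)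
    (2 • (innerSL ℝ x)) x := (hasStrictFDerivAt_norm_sq x).hasFDerivAt
  have h2 : HasFDerivAt (fun x : EuclideanSpace ℝ (Fin d) => -(‖x‖ ^ 2 / (4 * t)))
      (-((4 * t)⁻¹ • (2 • (innerSL ℝ x)))) x := by
    simp only [div_eq_mul_inv]
    exact (h1.mul_const ((4 * t)⁻¹)).neg
  have h3 := ((Complex.ofRealCLM.hasFDerivAt.comp x h2).mul_const Complex.I).cexp
  have h4 := h3.mul (hu.differentiable one_ne_zero x).hasFDerivAt
  have h5 : HasFDerivAt (gnTwist d t u) _ x := h4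
  rw [h5.fderiv]
  have ht' : (t:ℂ) ≠ 0 := by exact_mod_cast ht
  simp
  field_simp
  ring_nf
  simp

theorem gnTwist_fderiv_norm (d : ℕ) (t : ℝ) (ht : t ≠ 0) (u : EuclideanSpace ℝ (Fin d) → ℂ)
    (hu : ContDiff ℝ 1 u) (x : EuclideanSpace ℝ (Fin d)) :
    ‖fderiv ℝ (gnTwist d t u) x‖ ≤ |t|⁻¹ * ‖Jfield d t u x‖ := by
  have ht0 : 0 < |t| := abs_pos.2 ht
  refine ContinuousLinearMap.opNorm_le_bound _ (by positivity) fun h => ?_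
  have e0 := congrArg norm (gnTwist_fderiv d t ht u hu x h)
  rw [norm_mul, norm_mul, norm_mul, norm_mul, Complex.norm_exp_ofReal_mul_I, one_mul] at e0
  have e1 : ((inner ℝ x h : ℝ) : ℂ) * u x + 2 * Complex.I * t * fderiv ℝ u x h =
      ∑ j, (h j : ℂ) * (Jfield d t u x) j := by
    have eh : fderiv ℝ u x h = ∑ j, (h j : ℂ) * fderiv ℝ u x (EuclideanSpace.single j 1) := by
      have : h = ∑ j, h j • EuclideanSpace.single j (1:ℝ) := by
        have := (EuclideanSpace.basisFun (Fin d) ℝ).sum_repr h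
        simpa using this.symm
      conv_lhs => rw [this]
      simp
    rw [eh, PiLp.inner_apply]
    push_cast
    rw [Finset.mul_sum, Finset.sum_mul, ← Finset.sum_add_distrib]
    refine Finset.sum_congr rfl fun j _ => ?_
    simp [Jfield]
    ring
  rw [e1] at e0
  have e2 : ‖∑ j, (h j : ℂ) * (Jfield d t u x) j‖ ≤ ‖h‖ * ‖Jfield d t u x‖ := by
    refine (norm_sum_le _ _).trans ?_
    simp only [norm_mul]
    refine (Real.sum_mul_le_sqrt_mul_sqrt _ _ _).trans (le_of_eq ?_)
    rw [EuclideanSpace.norm_eq, EuclideanSpace.norm_eq]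
    simp
  rw [← e0] at e2
  simp at e2
  have hn := norm_nonneg (fderiv ℝ (gnTwist d t u) x h)
  have e3 : |t| * ‖fderiv ℝ (gnTwist d t u) x h‖ ≤ ‖h‖ * ‖Jfield d t u x‖ := by
    nlinarith [mul_nonneg ht0.le hn]
  calc ‖fderiv ℝ (gnTwist d t u) x h‖ = |t|⁻¹ * (|t| * ‖fderiv ℝ (gnTwist d t u) x h‖) := by
        field_simp
    _ ≤ |t|⁻¹ * (‖h‖ * ‖Jfield d t u x‖) := by gcongr
    _ = _ := by ring

/-- **Decay estimate associated to `J(t)`.** For `d ≥ 1`, `2 ≤ r < ∞` with additionally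
`r < 2d/(d-2)` when `d ≥ 3`, and `θ = d(r-2)/(2r)`, there is `C = C(d,r) > 0` such that
`‖u‖_{L^r} ≤ C |t|^{-θ} ‖u‖_{L²}^{1-θ} ‖J(t)u‖_{L²}^θ` for all `t ≠ 0` and Schwartz `u`. -/
theorem J_decay_estimate (d : ℕ) (hd : 1 ≤ d) (r : ℝ) (hr2 : 2 ≤ r)
    (hrd : 3 ≤ d → r < 2 * d / (d - 2)) :
    ∃ C > (0 : ℝ), ∀ (t : ℝ), t ≠ 0 →
      ∀ u : SchwartzMap (EuclideanSpace ℝ (Fin d)) ℂ,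
        eLpNorm (⇑u) (ENNReal.ofReal r) volume ≤
          ENNReal.ofReal (C * |t| ^ (-((d : ℝ) * (r - 2) / (2 * r)))) *
            eLpNorm (⇑u) 2 volume ^ (1 - (d : ℝ) * (r - 2) / (2 * r)) *
            eLpNorm (Jfield d t ⇑u) 2 volume ^ ((d : ℝ) * (r - 2) / (2 * r)) := by
  obtain ⟨C, hC⟩ := gn_general d hd r hr2 hrd
  refine ⟨(C : ℝ) + 1, by positivity, fun t ht u => ?_⟩
  have ht0 : 0 < |t| := abs_pos.2 ht
  have hu : ContDiff ℝ 1 u := u.smooth 1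
  have hn : ∀ p, eLpNorm (gnTwist d t u) p volume = eLpNorm u p volume := fun p =>
    eLpNorm_congr_norm_ae (Filter.Eventually.of_forall fun x => gnTwist_norm d t u x)
  have hfin : eLpNorm (gnTwist d t u) 2 volume ≠ ∞ := by
    rw [hn]
    exact (u.memLp 2 volume).eLpNorm_ne_top
  have key := hC (gnTwist d t u) (gnTwist_contDiff d t u hu) hfin
  rw [hn, hn] at key
  set s : ℝ := (d : ℝ) * (r - 2) / (2 * r) with hs
  have hs0 : 0 ≤ s := div_nonneg (mul_nonneg (by positivity) (by linarith)) (by linarith)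
  have hJ : eLpNorm (fderiv ℝ (gnTwist d t u)) 2 volume ≤
      ENNReal.ofReal (|t|⁻¹) * eLpNorm (Jfield d t u) 2 volume :=
    eLpNorm_le_mul_eLpNorm_of_ae_le_mul
      (Filter.Eventually.of_forall fun x => gnTwist_fderiv_norm d t ht u hu x) 2
  refine key.trans ((mul_le_mul_right (ENNReal.rpow_le_rpow hJ hs0) _).trans ?_)
  rw [ENNReal.mul_rpow_of_nonneg _ _ hs0, ENNReal.ofReal_rpow_of_nonneg (by positivity) hs0,
    Real.inv_rpow ht0.le, ← Real.rpow_neg ht0.le, ENNReal.ofReal_mul (by positivity)]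
  have hCC : (C : ℝ≥0∞) ≤ ENNReal.ofReal ((C:ℝ) + 1) := by
    rw [← ENNReal.ofReal_coe_nnreal]
    exact ENNReal.ofReal_le_ofReal (by linarith)
  calc _ = (C : ℝ≥0∞) * ENNReal.ofReal (|t| ^ (-s)) * eLpNorm u 2 volume ^ (1 - s) *
        eLpNorm (Jfield d t u) 2 volume ^ s := by ring
    _ ≤ _ := by gcongr
end
end

section
/- Let d ≥ 1, 0 < γ < d, and r = 4d/(2d-γ), with r' the Hölder conjugate of r. There exists a constant C = C(d,γ) > 0 such that for all measurable u,v,w : ℝ^d → ℂ with finite L^r norms, the integral ∫_{ℝ^d} |x−y|^{-γ} u(y) \overline{v(y)} dy converges absolutely for almost every x, and ‖T(u,v,w)‖_{L^{r'}(ℝ^d)} ≤ C ‖u‖_{L^r} ‖v‖_{L^r} ‖w‖_{L^r}. -/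
open MeasureTheory Complex
open scoped ENNReal NNReal

noncomputable section
/-- The trilinear Hartree form `T(u,v,w)(x) = (∫ |x-y|^{-γ} u(y) conj(v(y)) dy) · w(x)`,
i.e. `T(u,v,w) = (|x|^{-γ} * (u v̄)) w`. -/
def hartreeT (d : ℕ) (γ : ℝ) (u v w : EuclideanSpace ℝ (Fin d) → ℂ)
    (x : EuclideanSpace ℝ (Fin d)) : ℂ :=
  (∫ y : EuclideanSpace ℝ (Fin d),
      ((‖x - y‖ ^ (-γ) : ℝ) : ℂ) * (u y * (starRingEnd ℂ) (v y))) * w x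

namespace HartreeAux

/-- the Riesz kernel with values in `ℝ≥0∞` -/
def ker (d : ℕ) (γ : ℝ) (z : EuclideanSpace ℝ (Fin d)) : ℝ≥0∞ := ENNReal.ofReal (‖z‖ ^ (-γ))

lemma measurable_ker (d : ℕ) (γ : ℝ) : Measurable (ker d γ) := by
  unfold ker; fun_prop

lemma ker_sub_comm (d : ℕ) (γ : ℝ) (x y : EuclideanSpace ℝ (Fin d)) :
    ker d γ (x - y) = ker d γ (y - x) := by
  unfold ker; rw [norm_sub_rev]

lemma scale (d : ℕ) {R : ℝ} (hR : 0 < R) {F : EuclideanSpace ℝ (Fin d) → ℝ≥0∞}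
    (hF : Measurable F) :
    ∫⁻ z, F z = ENNReal.ofReal (R ^ (d : ℝ)) * ∫⁻ z, F (R • z) := by
  have h := lintegral_map (μ := (volume : Measure (EuclideanSpace ℝ (Fin d)))) hF
    (measurable_const_smul R)
  rw [Measure.map_addHaar_smul _ hR.ne', lintegral_smul_measure] at h
  rw [← h, smul_eq_mul, ← mul_assoc, ← ENNReal.ofReal_mul (by positivity)]
  have : R ^ (d : ℝ) * |(R ^ Module.finrank ℝ (EuclideanSpace ℝ (Fin d)))⁻¹| = 1 := by
    rw [abs_of_pos (by positivity), finrank_euclideanSpace_fin, Real.rpow_natCast]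
    field_simp
  rw [this]; simp

lemma inner_bound (d : ℕ) (hd : 1 ≤ d) (γ : ℝ) (hγd : γ < d) :
    ∃ C : ℝ≥0∞, C ≠ ∞ ∧ ∀ R : ℝ, 0 < R →
      ∫⁻ z, (Metric.ball (0 : EuclideanSpace ℝ (Fin d)) R).indicator (ker d γ) z
        ≤ C * ENNReal.ofReal (R ^ (d - γ)) := by
  refine ⟨∫⁻ z, (Metric.ball (0 : EuclideanSpace ℝ (Fin d)) 1).indicator (ker d γ) z, ?_, ?_⟩
  · have h := integrableOn_ball_of_norm_le_rpow (E := EuclideanSpace ℝ (Fin d)) (μ := volume)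
      (by simpa using hd) (f := fun x => ‖x‖ ^ (-γ)) (C := 1) (α := γ) (r := 1)
      (by simpa using hγd) (by
        refine Filter.Eventually.of_forall fun x => ?_
        rw [one_mul, Real.norm_of_nonneg (by positivity)])
      (Measurable.aestronglyMeasurable (by fun_prop))
    rw [lintegral_indicator measurableSet_ball]
    have h2 := h.2
    rw [hasFiniteIntegral_iff_ofReal (Filter.Eventually.of_forall fun x => by positivity)] at h2
    exact h2.ne
  · intro R hR
    rw [scale d hR ((measurable_ker d γ).indicator measurableSet_ball)]
    have : ∀ z : EuclideanSpace ℝ (Fin d),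
        (Metric.ball (0 : EuclideanSpace ℝ (Fin d)) R).indicator (ker d γ) (R • z) =
        ENNReal.ofReal (R ^ (-γ)) *
          (Metric.ball (0 : EuclideanSpace ℝ (Fin d)) 1).indicator (ker d γ) z := by
      intro z
      by_cases hz : ‖z‖ < 1
      · have : R * ‖z‖ < R := by nlinarith
        simp [Set.indicator, ker, norm_smul, abs_of_pos hR, hz, this]
        rw [Real.mul_rpow hR.le (norm_nonneg _), ENNReal.ofReal_mul (by positivity)]
      · have : ¬ R * ‖z‖ < R := by nlinarith
        simp [Set.indicator, norm_smul, abs_of_pos hR, hz, this]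
    simp_rw [this]
    rw [lintegral_const_mul _ ((measurable_ker d γ).indicator measurableSet_ball), ← mul_assoc,
      ← ENNReal.ofReal_mul (by positivity), ← Real.rpow_add hR, mul_comm, sub_eq_add_neg]

lemma outer_bound (d : ℕ) (hd : 1 ≤ d) (γ : ℝ) (hγ : 0 < γ) :
    ∃ C : ℝ≥0∞, C ≠ ∞ ∧ ∀ R : ℝ, 0 < R →
      ∫⁻ z, ((Metric.ball (0 : EuclideanSpace ℝ (Fin d)) R)ᶜ.indicator (ker d γ) z) ^ (2 * d / γ)
        ≤ C * ENNReal.ofReal (R ^ (-(d : ℝ))) := by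
  have hd' : (0 : ℝ) < d := by exact_mod_cast hd
  have hq : 0 < 2 * d / γ := by positivity
  have hm : ∀ R : ℝ, Measurable fun z =>
      ((Metric.ball (0 : EuclideanSpace ℝ (Fin d)) R)ᶜ.indicator (ker d γ) z) ^ (2 * d / γ) :=
    fun R => ((measurable_ker d γ).indicator measurableSet_ball.compl).pow_const _
  refine ⟨∫⁻ z, ((Metric.ball (0 : EuclideanSpace ℝ (Fin d)) 1)ᶜ.indicator (ker d γ) z)
    ^ (2 * d / γ), ?_, ?_⟩
  · have h := finite_integral_one_add_norm (E := EuclideanSpace ℝ (Fin d)) (μ := volume)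
      (r := 2 * d) (by simp; linarith)
    refine ne_of_lt (lt_of_le_of_lt (lintegral_mono (g := fun z =>
      ENNReal.ofReal (2 ^ (2 * d : ℝ)) * ENNReal.ofReal ((1 + ‖z‖) ^ (-(2 * d : ℝ)))) ?_) ?_)
    · intro z
      by_cases hz : ‖z‖ < 1
      · simp [Set.indicator, hz, ENNReal.zero_rpow_of_pos hq]
      · have hz1 : 1 ≤ ‖z‖ := not_lt.mp hz
        simp only [Set.indicator, Set.mem_compl_iff, mem_ball_zero_iff, hz, not_false_eq_true,
          if_true, ker]
        rw [ENNReal.ofReal_rpow_of_nonneg (by positivity) hq.le, ← Real.rpow_mul (by positivity),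
          ← ENNReal.ofReal_mul (by positivity)]
        apply ENNReal.ofReal_le_ofReal
        have e : -γ * (2 * d / γ) = -(2 * d) := by field_simp
        rw [e, Real.rpow_neg (by positivity), Real.rpow_neg (by positivity),
          ← Real.inv_rpow (by positivity), ← Real.inv_rpow (by positivity),
          ← Real.mul_rpow (by positivity) (by positivity)]
        apply Real.rpow_le_rpow (by positivity) _ (by positivity)
        rw [← div_eq_mul_inv, inv_eq_one_div, div_le_div_iff₀ (by positivity) (by positivity)]
        linarith
    · rw [lintegral_const_mul _ (by fun_prop)]
      exact ENNReal.mul_lt_top ENNReal.ofReal_lt_top h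
  · intro R hR
    rw [scale d hR (hm R)]
    have : ∀ z : EuclideanSpace ℝ (Fin d),
        ((Metric.ball (0 : EuclideanSpace ℝ (Fin d)) R)ᶜ.indicator (ker d γ) (R • z))
          ^ (2 * d / γ) =
        ENNReal.ofReal (R ^ (-(2 * d : ℝ))) *
          ((Metric.ball (0 : EuclideanSpace ℝ (Fin d)) 1)ᶜ.indicator (ker d γ) z)
            ^ (2 * d / γ) := by
      intro z
      by_cases hz : ‖z‖ < 1
      · have : R * ‖z‖ < R := by nlinarith
        simp [Set.indicator, norm_smul, abs_of_pos hR, hz, this, ENNReal.zero_rpow_of_pos hq]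
      · have : ¬ R * ‖z‖ < R := by nlinarith
        have e : -γ * (2 * d / γ) = -(2 * d) := by field_simp
        simp only [Set.indicator, ker, norm_smul, Real.norm_eq_abs, abs_of_pos hR, hz, this,
          Set.mem_compl_iff, mem_ball_zero_iff, not_false_eq_true, if_true]
        rw [Real.mul_rpow hR.le (norm_nonneg _), ENNReal.ofReal_mul (by positivity),
          ENNReal.mul_rpow_of_nonneg _ _ hq.le,
          ENNReal.ofReal_rpow_of_nonneg (by positivity) hq.le, ← Real.rpow_mul hR.le, e]
    simp_rw [this]
    rw [lintegral_const_mul _ (hm 1), ← mul_assoc,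
      ← ENNReal.ofReal_mul (by positivity), ← Real.rpow_add hR, mul_comm]
    apply le_of_eq
    congr 3
    ring

lemma trunc_bound (d : ℕ) (hd : 1 ≤ d) (γ : ℝ) (hγ0 : 0 < γ) (hγd : γ < d) :
    ∃ C : ℝ≥0∞, C ≠ ∞ ∧ ∀ g : EuclideanSpace ℝ (Fin d) → ℝ≥0∞, Measurable g →
      ∫⁻ y, g y ^ (2 * d / (2 * d - γ)) ≤ 1 → ∀ (a : ℝ≥0∞) (x : EuclideanSpace ℝ (Fin d)),
      ∫⁻ y, {y | g y ≤ a}.indicator g y * ker d γ (x - y) ≤ C * a ^ (γ / (2 * d - γ)) := by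
  have hd' : (0 : ℝ) < d := by exact_mod_cast hd
  have hD : 0 < 2 * d - γ := by linarith
  obtain ⟨C1, hC1, h1⟩ := inner_bound d hd γ hγd
  obtain ⟨C2, hC2, h2⟩ := outer_bound d hd γ hγ0
  have hs : 0 < γ / (2 * d - γ) := by positivity
  refine ⟨C1 + C2 ^ (γ / (2 * d)) + 1, ?_, ?_⟩
  · have : C2 ^ (γ / (2 * d)) ≠ ∞ := ENNReal.rpow_ne_top_of_nonneg (by positivity) hC2
    finiteness
  intro g hg hg1 a x
  rcases eq_or_ne a ∞ with rfl | ha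
  · rw [ENNReal.top_rpow_of_pos hs, ENNReal.mul_top (by simp)]
    exact le_top
  rcases eq_or_ne a 0 with rfl | ha0
  · have : ∀ y, {y | g y ≤ 0}.indicator g y * ker d γ (x - y) = 0 := by
      intro y
      by_cases h : g y = 0 <;> simp [Set.indicator, h]
    rw [lintegral_congr this]; simp
  lift a to ℝ≥0 using ha
  have hapos : 0 < (a : ℝ) := by
    have : a ≠ 0 := by simpa using ha0
    positivity
  set R : ℝ := (a : ℝ) ^ (-2 / (2 * d - γ)) with hRdef
  have hR : 0 < R := by positivity
  set K1 := (Metric.ball (0 : EuclideanSpace ℝ (Fin d)) R).indicator (ker d γ)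
  set K2 := (Metric.ball (0 : EuclideanSpace ℝ (Fin d)) R)ᶜ.indicator (ker d γ)
  have mK1 : Measurable K1 := (measurable_ker d γ).indicator measurableSet_ball
  have mK2 : Measurable K2 := (measurable_ker d γ).indicator measurableSet_ball.compl
  have haof : (a : ℝ≥0∞) = ENNReal.ofReal a := by simp
  have hK : ∀ z, ker d γ z = K1 z + K2 z := by
    intro z
    exact (Set.indicator_self_add_compl_apply _ _ z).symm
  have hpt : ∀ y, {y | g y ≤ a}.indicator g y * ker d γ (x - y) ≤
      a * K1 (x - y) + g y * K2 (x - y) := by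
    intro y
    rw [hK, mul_add]
    by_cases h : g y ≤ a
    · simp only [Set.indicator, Set.mem_ofPred_eq, h, if_true]
      gcongr
    · simp [Set.indicator, h]
  have hconj : (2 * d / (2 * d - γ)).HolderConjugate (2 * d / γ) := by
    rw [Real.holderConjugate_iff]
    constructor
    · rw [lt_div_iff₀ hD]; linarith
    · field_simp; ring
  have hH := ENNReal.lintegral_mul_le_Lp_mul_Lq volume hconj hg.aemeasurable
    (mK2.comp (measurable_const.sub measurable_id) : Measurable fun y => K2 (x - y)).aemeasurable
  have hT : ∫⁻ y, K2 (x - y) ^ (2 * d / γ) = ∫⁻ y, K2 y ^ (2 * d / γ) :=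
    lintegral_sub_left_eq_self (fun z => K2 z ^ (2 * d / γ)) x
  calc _ ≤ ∫⁻ y, (a * K1 (x - y) + g y * K2 (x - y)) := lintegral_mono hpt
    _ = a * (∫⁻ y, K1 y) + ∫⁻ y, g y * K2 (x - y) := by
        have m1 : Measurable fun y => K1 (x - y) := mK1.comp (measurable_const.sub measurable_id)
        rw [lintegral_add_left (m1.const_mul _), lintegral_const_mul _ m1,
          lintegral_sub_left_eq_self K1 x]
    _ ≤ a * (C1 * ENNReal.ofReal (R ^ (d - γ))) +
        1 * (C2 * ENNReal.ofReal (R ^ (-(d : ℝ)))) ^ (1 / (2 * d / γ)) := by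
        gcongr
        · exact h1 R hR
        · refine hH.trans ?_
          change _ * (∫⁻ y, K2 (x - y) ^ (2 * d / γ)) ^ (1 / (2 * d / γ)) ≤ _
          rw [hT]
          have := h2 R hR
          gcongr
          exact ENNReal.rpow_le_one hg1 (by positivity)
    _ = C1 * (a : ℝ≥0∞) ^ (γ / (2 * d - γ)) +
          C2 ^ (γ / (2 * d)) * (a : ℝ≥0∞) ^ (γ / (2 * d - γ)) := by
        have e1 : (a : ℝ≥0∞) * ENNReal.ofReal (R ^ (d - γ)) = (a : ℝ≥0∞) ^ (γ / (2 * d - γ)) := by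
          rw [haof, ENNReal.ofReal_rpow_of_pos hapos, ← ENNReal.ofReal_mul hapos.le, hRdef,
            ← Real.rpow_mul hapos.le]
          nth_rewrite 1 [← Real.rpow_one (a : ℝ)]
          rw [← Real.rpow_add hapos]
          congr 2
          field_simp
          ring
        have e2 : (ENNReal.ofReal (R ^ (-(d : ℝ)))) ^ (γ / (2 * d)) =
            (a : ℝ≥0∞) ^ (γ / (2 * d - γ)) := by
          rw [haof, ENNReal.ofReal_rpow_of_pos hapos, ENNReal.ofReal_rpow_of_pos (by positivity),
            hRdef, ← Real.rpow_mul hapos.le, ← Real.rpow_mul hapos.le]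
          congr 2
          field_simp
        rw [one_div_div, ENNReal.mul_rpow_of_nonneg _ _ (by positivity), e2, one_mul, ← e1]
        ring
    _ ≤ _ := by
        rw [← add_mul]
        exact mul_le_mul_left le_self_add _

lemma bilin_half (d : ℕ) (hd : 1 ≤ d) (γ : ℝ) (hγ0 : 0 < γ) (hγd : γ < d) :
    ∃ C : ℝ≥0∞, C ≠ ∞ ∧ ∀ f g : EuclideanSpace ℝ (Fin d) → ℝ≥0∞, Measurable f → Measurable g →
      ∫⁻ y, f y ^ (2 * d / (2 * d - γ)) ≤ 1 → ∫⁻ y, g y ^ (2 * d / (2 * d - γ)) ≤ 1 →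
      ∫⁻ x, ∫⁻ y, f x * ({y | g y ≤ f x}.indicator g y * ker d γ (x - y)) ≤ C := by
  have hd' : (0 : ℝ) < d := by exact_mod_cast hd
  have hD : 0 < 2 * d - γ := by linarith
  obtain ⟨C, hC, h⟩ := trunc_bound d hd γ hγ0 hγd
  refine ⟨C, hC, fun f g hf hg hf1 hg1 => ?_⟩
  calc _ ≤ ∫⁻ x, C * f x ^ (2 * d / (2 * d - γ)) := by
        refine lintegral_mono fun x => ?_
        have hm : Measurable fun y => {y | g y ≤ f x}.indicator g y * ker d γ (x - y) :=
          (hg.indicator (measurableSet_le hg measurable_const)).mul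
            ((measurable_ker d γ).comp (measurable_const.sub measurable_id))
        rw [lintegral_const_mul _ hm]
        refine (mul_le_mul_right (h g hg hg1 (f x) x) (f x)).trans_eq ?_
        have e : 2 * d / (2 * d - γ) = 1 + γ / (2 * d - γ) := by field_simp; ring
        rw [e, ENNReal.rpow_add_of_nonneg _ _ zero_le_one (by positivity), ENNReal.rpow_one]
        ring
    _ = C * ∫⁻ x, f x ^ (2 * d / (2 * d - γ)) := lintegral_const_mul _ (hf.pow_const _)
    _ ≤ C * 1 := by gcongr
    _ = C := mul_one C

lemma bilin (d : ℕ) (hd : 1 ≤ d) (γ : ℝ) (hγ0 : 0 < γ) (hγd : γ < d) :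
    ∃ C : ℝ≥0∞, C ≠ ∞ ∧ ∀ f g : EuclideanSpace ℝ (Fin d) → ℝ≥0∞, Measurable f → Measurable g →
      ∫⁻ y, f y ^ (2 * d / (2 * d - γ)) ≤ 1 → ∫⁻ y, g y ^ (2 * d / (2 * d - γ)) ≤ 1 →
      ∫⁻ x, f x * ∫⁻ y, g y * ker d γ (x - y) ≤ C := by
  obtain ⟨C, hC, h⟩ := bilin_half d hd γ hγ0 hγd
  refine ⟨C + C, by finiteness, fun f g hf hg hf1 hg1 => ?_⟩
  have hmk : Measurable fun z : EuclideanSpace ℝ (Fin d) × EuclideanSpace ℝ (Fin d) =>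
      ker d γ (z.1 - z.2) := (measurable_ker d γ).comp (measurable_fst.sub measurable_snd)
  have hm1 : Measurable fun z : EuclideanSpace ℝ (Fin d) × EuclideanSpace ℝ (Fin d) =>
      f z.1 * ({y | g y ≤ f z.1}.indicator g z.2 * ker d γ (z.1 - z.2)) := by
    have : Measurable fun z : EuclideanSpace ℝ (Fin d) × EuclideanSpace ℝ (Fin d) =>
        {y | g y ≤ f z.1}.indicator g z.2 := by
      have := (hg.comp measurable_snd : Measurable fun z : EuclideanSpace ℝ (Fin d) ×
        EuclideanSpace ℝ (Fin d) => g z.2).indicator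
        (measurableSet_le (hg.comp measurable_snd) (hf.comp measurable_fst))
      exact this
    exact (hf.comp measurable_fst).mul (this.mul hmk)
  have hm2 : Measurable fun z : EuclideanSpace ℝ (Fin d) × EuclideanSpace ℝ (Fin d) =>
      g z.2 * ({x | f x ≤ g z.2}.indicator f z.1 * ker d γ (z.2 - z.1)) := by
    have : Measurable fun z : EuclideanSpace ℝ (Fin d) × EuclideanSpace ℝ (Fin d) =>
        {x | f x ≤ g z.2}.indicator f z.1 := by
      have := (hf.comp measurable_fst : Measurable fun z : EuclideanSpace ℝ (Fin d) ×
        EuclideanSpace ℝ (Fin d) => f z.1).indicator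
        (measurableSet_le (hf.comp measurable_fst) (hg.comp measurable_snd))
      exact this
    exact (hg.comp measurable_snd).mul (this.mul
      ((measurable_ker d γ).comp (measurable_snd.sub measurable_fst)))
  calc _ ≤ ∫⁻ x, ∫⁻ y, (f x * ({y | g y ≤ f x}.indicator g y * ker d γ (x - y)) +
          g y * ({x | f x ≤ g y}.indicator f x * ker d γ (y - x))) := by
        refine lintegral_mono fun x => ?_
        have hm : Measurable fun y => g y * ker d γ (x - y) :=
          hg.mul ((measurable_ker d γ).comp (measurable_const.sub measurable_id))
        simp only
        rw [← lintegral_const_mul _ hm]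
        refine lintegral_mono fun y => ?_
        simp only
        rw [ker_sub_comm d γ y x]
        rcases le_total (g y) (f x) with h | h
        · refine le_trans (le_of_eq ?_) le_self_add
          simp [Set.indicator, h]
        · refine le_trans (le_of_eq ?_) le_add_self
          simp [Set.indicator, h]
          ring
    _ = (∫⁻ x, ∫⁻ y, f x * ({y | g y ≤ f x}.indicator g y * ker d γ (x - y))) +
        ∫⁻ x, ∫⁻ y, g y * ({x | f x ≤ g y}.indicator f x * ker d γ (y - x)) := by
        rw [← lintegral_add_left hm1.lintegral_prod_right']
        refine lintegral_congr fun x => ?_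
        have hmx : Measurable fun y =>
            f x * ({y | g y ≤ f x}.indicator g y * ker d γ (x - y)) :=
          hm1.comp measurable_prodMk_left
        rw [lintegral_add_left hmx]
    _ ≤ C + C := by
        gcongr
        · exact h f g hf hg hf1 hg1
        · rw [lintegral_lintegral_swap hm2.aemeasurable]
          exact h g f hg hf hg1 hf1

lemma riesz_unit (d : ℕ) (hd : 1 ≤ d) (γ : ℝ) (hγ0 : 0 < γ) (hγd : γ < d) :
    ∃ C : ℝ≥0∞, C ≠ ∞ ∧ ∀ f : EuclideanSpace ℝ (Fin d) → ℝ≥0∞, Measurable f →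
      ∫⁻ y, f y ^ (2 * d / (2 * d - γ)) ≤ 1 →
      ∫⁻ x, (∫⁻ y, f y * ker d γ (x - y)) ^ (2 * d / γ) ≤ C := by
  have hd' : (0 : ℝ) < d := by exact_mod_cast hd
  have hD : 0 < 2 * d - γ := by linarith
  have hq : 0 < 2 * d / γ := by positivity
  have hp : 0 < 2 * d / (2 * d - γ) := by positivity
  obtain ⟨C, hC, h⟩ := bilin d hd γ hγ0 hγd
  refine ⟨C ^ (2 * d / γ), by finiteness, fun f hf hf1 => ?_⟩
  set I := fun x => ∫⁻ y, f y * ker d γ (x - y) with hI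
  have hmI : Measurable I := by
    have : Measurable fun z : EuclideanSpace ℝ (Fin d) × EuclideanSpace ℝ (Fin d) =>
      f z.2 * ker d γ (z.1 - z.2) :=
      (hf.comp measurable_snd).mul ((measurable_ker d γ).comp (measurable_fst.sub measurable_snd))
    exact this.lintegral_prod_right'
  set H : ℕ → EuclideanSpace ℝ (Fin d) → ℝ≥0∞ := fun n =>
    (Metric.ball 0 n).indicator (fun x => min (I x) n) with hH
  have hmH : ∀ n, Measurable (H n) := fun n =>
    (hmI.min measurable_const).indicator measurableSet_ball
  have hHI : ∀ n x, H n x ≤ I x := by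
    intro n x
    refine (Set.indicator_le_self _ _ _).trans (min_le_left _ _)
  have hmono : Monotone fun n x => H n x ^ (2 * d / γ) := by
    intro m n hmn x
    refine ENNReal.rpow_le_rpow ?_ hq.le
    simp only [hH, Set.indicator, mem_ball_zero_iff]
    have hmn' : (m : ℝ) ≤ n := by exact_mod_cast hmn
    have hmn'' : (m : ℝ≥0∞) ≤ n := by exact_mod_cast hmn
    split_ifs with h1 h2
    · exact min_le_min le_rfl hmn''
    · exact absurd (h1.trans_le hmn') h2
    · exact zero_le
    · exact zero_le
  have hsup : ∀ x, I x ^ (2 * d / γ) ≤ ⨆ n, H n x ^ (2 * d / γ) := by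
    intro x
    refine le_of_forall_lt fun c hc => ?_
    obtain ⟨N, hN⟩ := exists_nat_gt ‖x‖
    have hc' : c ^ (1 / (2 * d / γ)) < I x := by
      have := ENNReal.rpow_lt_rpow hc (z := 1 / (2 * d / γ)) (by positivity)
      rwa [← ENNReal.rpow_mul, mul_one_div_cancel hq.ne', ENNReal.rpow_one] at this
    obtain ⟨M, hM⟩ := ENNReal.exists_nat_gt (hc'.trans_le le_top).ne
    refine lt_of_lt_of_le ?_ (le_iSup _ (max N M))
    have : c ^ (1 / (2 * d / γ)) < H (max N M) x := by
      have hx : ‖x‖ < ((max N M : ℕ) : ℝ) := hN.trans_le (by exact_mod_cast le_max_left N M)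
      simp only [hH, Set.indicator, mem_ball_zero_iff, hx, if_true]
      exact lt_min hc' (hM.trans_le (by exact_mod_cast le_max_right N M))
    have := ENNReal.rpow_lt_rpow this hq
    rwa [← ENNReal.rpow_mul, one_div_mul_cancel hq.ne', ENNReal.rpow_one] at this
  refine (lintegral_mono hsup).trans ?_
  rw [lintegral_iSup (fun n => (hmH n).pow_const _) hmono]
  refine iSup_le fun n => ?_
  set J := ∫⁻ x, H n x ^ (2 * d / γ) with hJ
  have hJtop : J ≠ ∞ := by
    have : J ≤ ∫⁻ x, (Metric.ball (0 : EuclideanSpace ℝ (Fin d)) n).indicator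
        (fun _ => (n : ℝ≥0∞) ^ (2 * d / γ)) x := by
      refine lintegral_mono fun x => ?_
      simp only [hH, Set.indicator]
      split_ifs
      · exact ENNReal.rpow_le_rpow (min_le_right _ _) hq.le
      · simp [ENNReal.zero_rpow_of_pos hq]
    refine ne_of_lt (this.trans_lt ?_)
    rw [lintegral_indicator measurableSet_ball, setLIntegral_const]
    exact ENNReal.mul_lt_top (ENNReal.rpow_lt_top_of_nonneg hq.le (by simp)) measure_ball_lt_top
  rcases eq_or_ne J 0 with hJ0 | hJ0
  · rw [hJ0]; exact zero_le
  set A := J ^ ((2 * d - γ) / (2 * d)) with hA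
  have hA0 : A ≠ 0 := (ENNReal.rpow_pos (pos_iff_ne_zero.mpr hJ0) hJtop).ne'
  have hAtop : A ≠ ∞ := ENNReal.rpow_ne_top_of_nonneg (by positivity) hJtop
  set g := fun x => A⁻¹ * H n x ^ (2 * d / γ - 1) with hg
  have hmg : Measurable g := ((hmH n).pow_const _).const_mul _
  have hq1 : 0 < 2 * d / γ - 1 := by
    rw [sub_pos, lt_div_iff₀ hγ0]; linarith
  have hg1 : ∫⁻ x, g x ^ (2 * d / (2 * d - γ)) ≤ 1 := by
    have : ∀ x, g x ^ (2 * d / (2 * d - γ)) = J⁻¹ * H n x ^ (2 * d / γ) := by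
      intro x
      rw [hg]
      simp only
      rw [ENNReal.mul_rpow_of_nonneg _ _ hp.le, ← ENNReal.rpow_mul, hA, ENNReal.inv_rpow,
        ← ENNReal.rpow_mul]
      have e1 : (2 * d - γ) / (2 * d) * (2 * d / (2 * d - γ)) = 1 := by field_simp
      have e2 : (2 * d / γ - 1) * (2 * d / (2 * d - γ)) = 2 * d / γ := by field_simp
      rw [e1, e2, ENNReal.rpow_one]
    simp_rw [this]
    rw [lintegral_const_mul _ ((hmH n).pow_const _), ENNReal.inv_mul_cancel hJ0 hJtop]
  have hb := h g f hmg hf hg1 hf1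
  have hJA : A⁻¹ * J ≤ C := by
    refine le_trans ?_ hb
    rw [hJ, ← lintegral_const_mul _ ((hmH n).pow_const _)]
    refine lintegral_mono fun x => ?_
    simp only [hg]
    rw [mul_assoc]
    refine mul_le_mul_right ?_ _
    have e : 2 * d / γ = (2 * d / γ - 1) + 1 := by ring
    nth_rewrite 1 [e]
    rw [ENNReal.rpow_add_of_nonneg _ _ hq1.le zero_le_one, ENNReal.rpow_one]
    exact mul_le_mul_right (hHI n x) _
  have hAJ : A⁻¹ * J = J ^ (1 / (2 * d / γ)) := by
    have e1 : A⁻¹ * J = A⁻¹ * J ^ (1 : ℝ) := by rw [ENNReal.rpow_one]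
    rw [e1, hA, ← ENNReal.rpow_neg, ← ENNReal.rpow_add _ _ hJ0 hJtop]
    congr 1
    field_simp
    ring
  rw [hAJ] at hJA
  have := ENNReal.rpow_le_rpow hJA hq.le
  rwa [← ENNReal.rpow_mul, one_div_mul_cancel hq.ne', ENNReal.rpow_one] at this

lemma riesz (d : ℕ) (hd : 1 ≤ d) (γ : ℝ) (hγ0 : 0 < γ) (hγd : γ < d) :
    ∃ C : ℝ≥0∞, C ≠ ∞ ∧ ∀ f : EuclideanSpace ℝ (Fin d) → ℝ≥0∞, Measurable f →
      ∫⁻ y, f y ^ (2 * d / (2 * d - γ)) ≠ ∞ →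
      (∫⁻ x, (∫⁻ y, f y * ker d γ (x - y)) ^ (2 * d / γ)) ^ (1 / (2 * d / γ)) ≤
        C * (∫⁻ y, f y ^ (2 * d / (2 * d - γ))) ^ (1 / (2 * d / (2 * d - γ))) := by
  have hd' : (0 : ℝ) < d := by exact_mod_cast hd
  have hD : 0 < 2 * d - γ := by linarith
  have hq : 0 < 2 * d / γ := by positivity
  have hp : 0 < 2 * d / (2 * d - γ) := by positivity
  obtain ⟨C, hC, h⟩ := riesz_unit d hd γ hγ0 hγd
  refine ⟨C ^ (1 / (2 * d / γ)), by finiteness, fun f hf hf1 => ?_⟩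
  set F := ∫⁻ y, f y ^ (2 * d / (2 * d - γ)) with hF
  rcases eq_or_ne F 0 with hF0 | hF0
  · have hz : ∀ᵐ y, f y = 0 := by
      have := (lintegral_eq_zero_iff (hf.pow_const _)).mp (hF ▸ hF0)
      filter_upwards [this] with y hy
      simpa [ENNReal.rpow_eq_zero_iff, hp, hp.not_gt] using hy
    have : ∀ x, ∫⁻ y, f y * ker d γ (x - y) = 0 := by
      intro x
      rw [lintegral_congr_ae (g := fun _ => 0)]
      · simp
      · filter_upwards [hz] with y hy
        simp [hy]
    simp only [this, ENNReal.zero_rpow_of_pos hq, lintegral_zero]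
    rw [ENNReal.zero_rpow_of_pos (by positivity)]
    exact zero_le
  set A := F ^ (1 / (2 * d / (2 * d - γ))) with hA
  have hA0 : A ≠ 0 := (ENNReal.rpow_pos (pos_iff_ne_zero.mpr hF0) hf1).ne'
  have hAtop : A ≠ ∞ := ENNReal.rpow_ne_top_of_nonneg (by positivity) hf1
  have hb := h (fun y => A⁻¹ * f y) (hf.const_mul _) (by
    have : ∀ x, (A⁻¹ * f x) ^ (2 * d / (2 * d - γ)) = F⁻¹ * f x ^ (2 * d / (2 * d - γ)) := by
      intro x
      rw [ENNReal.mul_rpow_of_nonneg _ _ hp.le, hA, ENNReal.inv_rpow,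
        ← ENNReal.rpow_mul, one_div_mul_cancel hp.ne', ENNReal.rpow_one]
    simp_rw [this]
    rw [lintegral_const_mul _ (hf.pow_const _), ENNReal.inv_mul_cancel hF0 hf1])
  have hmI : Measurable fun x => ∫⁻ y, f y * ker d γ (x - y) := by
    have : Measurable fun z : EuclideanSpace ℝ (Fin d) × EuclideanSpace ℝ (Fin d) =>
      f z.2 * ker d γ (z.1 - z.2) :=
      (hf.comp measurable_snd).mul ((measurable_ker d γ).comp (measurable_fst.sub measurable_snd))
    exact this.lintegral_prod_right'
  have e : ∀ x, (∫⁻ y, A⁻¹ * f y * ker d γ (x - y)) ^ (2 * d / γ) =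
      (A⁻¹) ^ (2 * d / γ) * (∫⁻ y, f y * ker d γ (x - y)) ^ (2 * d / γ) := by
    intro x
    simp_rw [mul_assoc]
    have hm : Measurable fun y => f y * ker d γ (x - y) :=
      hf.mul ((measurable_ker d γ).comp (measurable_const.sub measurable_id))
    rw [lintegral_const_mul _ hm,
      ENNReal.mul_rpow_of_nonneg _ _ hq.le]
  simp_rw [e] at hb
  rw [lintegral_const_mul _ (hmI.pow_const _)] at hb
  have hb2 := ENNReal.rpow_le_rpow hb (z := 1 / (2 * d / γ)) (by positivity)
  rw [ENNReal.mul_rpow_of_nonneg _ _ (by positivity), ← ENNReal.rpow_mul,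
    mul_one_div_cancel hq.ne', ENNReal.rpow_one] at hb2
  rw [mul_comm (C ^ (1 / (2 * d / γ))) A]
  refine le_trans (le_of_eq ?_) (mul_le_mul_right hb2 A)
  rw [← mul_assoc, ENNReal.mul_inv_cancel hA0 hAtop, one_mul]

end HartreeAux

/-- **Trilinear Hartree estimate.** For `d ≥ 1`, `0 < γ < d`, `r = 4d/(2d-γ)` and `r'`
its Hölder conjugate, there is `C = C(d,γ) > 0` such that for all measurable `u,v,w`
with finite `L^r` norms, the convolution integral converges absolutely for a.e. `x` and
`‖T(u,v,w)‖_{L^{r'}} ≤ C ‖u‖_{L^r} ‖v‖_{L^r} ‖w‖_{L^r}`. -/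
theorem hartreeT_estimate (d : ℕ) (hd : 1 ≤ d) (γ : ℝ) (hγ0 : 0 < γ) (hγd : γ < d)
    (r' : ℝ) (hconj : 1 / (4 * d / (2 * d - γ)) + 1 / r' = 1) :
    ∃ C > (0 : ℝ), ∀ u v w : EuclideanSpace ℝ (Fin d) → ℂ,
      Measurable u → Measurable v → Measurable w →
      eLpNorm u (ENNReal.ofReal (4 * d / (2 * d - γ))) volume < ∞ →
      eLpNorm v (ENNReal.ofReal (4 * d / (2 * d - γ))) volume < ∞ →
      eLpNorm w (ENNReal.ofReal (4 * d / (2 * d - γ))) volume < ∞ →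
      (∀ᵐ x : EuclideanSpace ℝ (Fin d) ∂volume,
          Integrable (fun y : EuclideanSpace ℝ (Fin d) =>
            ((‖x - y‖ ^ (-γ) : ℝ) : ℂ) * (u y * (starRingEnd ℂ) (v y))) volume) ∧
        eLpNorm (hartreeT d γ u v w) (ENNReal.ofReal r') volume ≤
          ENNReal.ofReal C *
            (eLpNorm u (ENNReal.ofReal (4 * d / (2 * d - γ))) volume *
              eLpNorm v (ENNReal.ofReal (4 * d / (2 * d - γ))) volume *
              eLpNorm w (ENNReal.ofReal (4 * d / (2 * d - γ))) volume) := by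
  have hd' : (0 : ℝ) < d := by exact_mod_cast hd
  have hD : 0 < 2 * d - γ := by linarith
  have hq : 0 < 2 * d / γ := by positivity
  have hp : 0 < 2 * d / (2 * d - γ) := by positivity
  have hr : 0 < 4 * d / (2 * d - γ) := by positivity
  have hr' : r' = 4 * d / (2 * d + γ) := by
    have h1 : 1 / r' = (2 * d + γ) / (4 * d) := by
      have : 1 / r' = 1 - 1 / (4 * d / (2 * d - γ)) := by linarith
      rw [this]; field_simp; ring
    rw [← one_div_one_div r', h1, one_div_div]
  have hr'0 : 0 < r' := by rw [hr']; positivity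
  obtain ⟨C, hC, h⟩ := HartreeAux.riesz d hd γ hγ0 hγd
  have T1 : ENNReal.HolderTriple (ENNReal.ofReal (4 * d / (2 * d - γ)))
      (ENNReal.ofReal (4 * d / (2 * d - γ))) (ENNReal.ofReal (2 * d / (2 * d - γ))) := by
    constructor
    rw [← ENNReal.ofReal_inv_of_pos hr, ← ENNReal.ofReal_inv_of_pos hp,
      ← ENNReal.ofReal_add (by positivity) (by positivity)]
    congr 1
    field_simp
    ring
  have T2 : ENNReal.HolderTriple (ENNReal.ofReal (2 * d / γ))
      (ENNReal.ofReal (4 * d / (2 * d - γ))) (ENNReal.ofReal r') := by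
    constructor
    rw [← ENNReal.ofReal_inv_of_pos hr, ← ENNReal.ofReal_inv_of_pos hq,
      ← ENNReal.ofReal_inv_of_pos hr'0, ← ENNReal.ofReal_add (by positivity) (by positivity)]
    congr 1
    rw [hr']
    field_simp
    ring
  refine ⟨C.toReal + 1, by positivity, fun u v w hu hv hw hu1 hv1 hw1 => ?_⟩
  have hCle : C ≤ ENNReal.ofReal (C.toReal + 1) := by
    rw [ENNReal.le_ofReal_iff_toReal_le hC (by positivity)]
    linarith
  set uv : EuclideanSpace ℝ (Fin d) → ℂ := fun y => u y * (starRingEnd ℂ) (v y) with huv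
  have hcv : Measurable fun y => (starRingEnd ℂ) (v y) :=
    Complex.continuous_conj.measurable.comp hv
  have hmuv : Measurable uv := hu.mul hcv
  have hnorm_uv : eLpNorm uv (ENNReal.ofReal (2 * d / (2 * d - γ))) volume ≤
      eLpNorm u (ENNReal.ofReal (4 * d / (2 * d - γ))) volume *
        eLpNorm v (ENNReal.ofReal (4 * d / (2 * d - γ))) volume := by
    have h1 := eLpNorm_smul_le_mul_eLpNorm (μ := volume)
      (p := ENNReal.ofReal (4 * d / (2 * d - γ))) (q := ENNReal.ofReal (4 * d / (2 * d - γ)))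
      (r := ENNReal.ofReal (2 * d / (2 * d - γ)))
      hcv.aestronglyMeasurable hu.aestronglyMeasurable
    refine h1.trans (le_of_eq ?_)
    congr 1
    exact eLpNorm_congr_norm_ae (Filter.Eventually.of_forall fun y => by simp)
  have hform : ∀ (s : ℝ), 0 < s → ∀ F : EuclideanSpace ℝ (Fin d) → ℂ,
      eLpNorm F (ENNReal.ofReal s) volume = (∫⁻ x, ‖F x‖ₑ ^ s) ^ (1 / s) := by
    intro s hs F
    rw [eLpNorm_eq_lintegral_rpow_enorm_toReal (by simpa using hs) (by simp),
      ENNReal.toReal_ofReal hs.le]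
  have huv_fin : eLpNorm uv (ENNReal.ofReal (2 * d / (2 * d - γ))) volume ≠ ∞ :=
    ne_of_lt (hnorm_uv.trans_lt (ENNReal.mul_lt_top hu1 hv1))
  have hpow_fin : ∫⁻ y, ‖uv y‖ₑ ^ (2 * d / (2 * d - γ)) ≠ ∞ := by
    intro hcon
    apply huv_fin
    rw [hform _ hp, hcon, ENNReal.top_rpow_of_pos (by positivity)]
  have hR := h (fun y => ‖uv y‖ₑ) hmuv.enorm hpow_fin
  rw [← hform _ hp uv] at hR
  set I := fun x => ∫⁻ y, ‖uv y‖ₑ * HartreeAux.ker d γ (x - y) with hI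
  have hmI : Measurable I := by
    have : Measurable fun z : EuclideanSpace ℝ (Fin d) × EuclideanSpace ℝ (Fin d) =>
      ‖uv z.2‖ₑ * HartreeAux.ker d γ (z.1 - z.2) :=
      (hmuv.enorm.comp measurable_snd).mul
        ((HartreeAux.measurable_ker d γ).comp (measurable_fst.sub measurable_snd))
    exact this.lintegral_prod_right'
  have hen : ∀ x y, ‖((‖x - y‖ ^ (-γ) : ℝ) : ℂ) * uv y‖ₑ =
      ‖uv y‖ₑ * HartreeAux.ker d γ (x - y) := by
    intro x y
    rw [enorm_mul, mul_comm]
    congr 1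
    rw [HartreeAux.ker, ← ofReal_norm, Complex.norm_real,
      Real.norm_of_nonneg (by positivity)]
  have hmk : Measurable fun z : EuclideanSpace ℝ (Fin d) × EuclideanSpace ℝ (Fin d) =>
      ((‖z.1 - z.2‖ ^ (-γ) : ℝ) : ℂ) * uv z.2 := by
    refine Measurable.mul ?_ (hmuv.comp measurable_snd)
    exact Complex.measurable_ofReal.comp (by fun_prop)
  have hIfin : ∫⁻ x, I x ^ (2 * d / γ) ≠ ∞ := by
    intro hcon
    rw [hcon, ENNReal.top_rpow_of_pos (by positivity), top_le_iff] at hR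
    exact ENNReal.mul_ne_top hC huv_fin hR
  refine ⟨?_, ?_⟩
  · filter_upwards [ae_lt_top (hmI.pow_const _) hIfin] with x hx
    have hx' : I x < ∞ := by
      by_contra hcon
      rw [not_lt, top_le_iff] at hcon
      rw [hcon, ENNReal.top_rpow_of_pos hq] at hx
      exact lt_irrefl _ hx
    have hmx : Measurable fun y => ((‖x - y‖ ^ (-γ) : ℝ) : ℂ) * uv y := by
      refine Measurable.mul ?_ hmuv
      exact Complex.measurable_ofReal.comp (by fun_prop)
    refine ⟨hmx.aestronglyMeasurable, ?_⟩
    rw [hasFiniteIntegral_iff_enorm]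
    refine lt_of_le_of_lt (le_of_eq ?_) hx'
    exact lintegral_congr fun y => hen x y
  · set P : EuclideanSpace ℝ (Fin d) → ℂ :=
      fun x => ∫ y, ((‖x - y‖ ^ (-γ) : ℝ) : ℂ) * uv y with hP
    have hmP : StronglyMeasurable P := hmk.stronglyMeasurable.integral_prod_right'
    have hTP : hartreeT d γ u v w = P • w := rfl
    have hPq : eLpNorm P (ENNReal.ofReal (2 * d / γ)) volume ≤
        C * eLpNorm uv (ENNReal.ofReal (2 * d / (2 * d - γ))) volume := by
      refine le_trans ?_ hR
      rw [hform _ hq]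
      refine ENNReal.rpow_le_rpow (lintegral_mono fun x => ?_) (by positivity)
      refine ENNReal.rpow_le_rpow ?_ hq.le
      refine (enorm_integral_le_lintegral_enorm _).trans (le_of_eq ?_)
      exact lintegral_congr fun y => hen x y
    rw [hTP]
    calc _ ≤ eLpNorm P (ENNReal.ofReal (2 * d / γ)) volume *
          eLpNorm w (ENNReal.ofReal (4 * d / (2 * d - γ))) volume :=
          eLpNorm_smul_le_mul_eLpNorm hw.aestronglyMeasurable hmP.aestronglyMeasurable
      _ ≤ (ENNReal.ofReal (C.toReal + 1) *
            (eLpNorm u (ENNReal.ofReal (4 * d / (2 * d - γ))) volume *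
              eLpNorm v (ENNReal.ofReal (4 * d / (2 * d - γ))) volume)) *
          eLpNorm w (ENNReal.ofReal (4 * d / (2 * d - γ))) volume := by
          gcongr
          exact hPq.trans (by gcongr)
      _ = _ := by ring
end
end

section
/- Let d ≥ 1, 0 < γ < d, and r = 4d/(2d-γ), with r' the Hölder conjugate of r. There exists a constant C = C(d,γ) > 0 such that for all Schwartz functions u₁,u₂,u₃ : ℝ^d → ℂ, the function T(u₁,u₂,u₃) is differentiable and ‖∇T(u₁,u₂,u₃)‖_{L^{r'}(ℝ^d)} ≤ C ∑_{i=1}^{3} ‖∇u_i‖_{L^r(ℝ^d)} ∏_{j≠i} ‖u_j‖_{L^r(ℝ^d)}, where ‖∇f‖_{L^r} denotes the L^r norm of the pointwise Euclidean norm of the gradient. -/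
open MeasureTheory Complex
open scoped ENNReal NNReal

noncomputable section
/-- The gradient of `u : ℝ^d → ℂ`, as a `ℂ^d`-valued function (components `∂_j u`). -/
def gradVec (d : ℕ) (u : EuclideanSpace ℝ (Fin d) → ℂ)
    (x : EuclideanSpace ℝ (Fin d)) : EuclideanSpace ℂ (Fin d) :=
  (WithLp.equiv 2 (Fin d → ℂ)).symm (fun j => fderiv ℝ u x (EuclideanSpace.single j 1))


lemma hls_scale (d : ℕ) {R : ℝ} (hR : 0 < R) (f : EuclideanSpace ℝ (Fin d) → ℝ≥0∞)
    (hf : Measurable f) :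
    ∫⁻ z, f (R⁻¹ • z) = ENNReal.ofReal R ^ (d : ℝ) * ∫⁻ z, f z := by
  have h := Measure.map_addHaar_smul (volume : Measure (EuclideanSpace ℝ (Fin d)))
    (inv_ne_zero hR.ne')
  have h2 : ∫⁻ z, f (R⁻¹ • z) = ∫⁻ z, f z ∂(Measure.map (fun z => R⁻¹ • z) volume) := by
    rw [lintegral_map hf (measurable_const_smul _)]
  rw [h2, h, lintegral_smul_measure]
  congr 1
  rw [finrank_euclideanSpace_fin, inv_pow, inv_inv, abs_of_nonneg (by positivity),
    ENNReal.rpow_natCast, ENNReal.ofReal_pow hR.le]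

lemma hls_power_scale (d : ℕ) (s : ℝ) (S : Set ℝ) (hS : MeasurableSet S) {R : ℝ} (hR : 0 < R) :
    ∫⁻ z : EuclideanSpace ℝ (Fin d), {z | R⁻¹ * ‖z‖ ∈ S}.indicator (fun z => ‖z‖ₑ ^ (-s)) z
      = (∫⁻ z : EuclideanSpace ℝ (Fin d), {z | ‖z‖ ∈ S}.indicator (fun z => ‖z‖ₑ ^ (-s)) z)
        * ENNReal.ofReal R ^ (d - s) := by
  have hR0 : ENNReal.ofReal R ≠ 0 := by simpa using hR
  have h := hls_scale d hR ({z | ‖z‖ ∈ S}.indicator (fun z => ‖z‖ₑ ^ (-s)))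
    (Measurable.indicator (by fun_prop) (measurable_norm hS))
  have h2 : ∀ z : EuclideanSpace ℝ (Fin d),
      {z : EuclideanSpace ℝ (Fin d) | ‖z‖ ∈ S}.indicator (fun z => ‖z‖ₑ ^ (-s)) (R⁻¹ • z)
      = ENNReal.ofReal R ^ s *
        {z : EuclideanSpace ℝ (Fin d) | R⁻¹ * ‖z‖ ∈ S}.indicator (fun z => ‖z‖ₑ ^ (-s)) z := by
    intro z
    have e1 : ‖R⁻¹ • z‖ = R⁻¹ * ‖z‖ := by
      rw [norm_smul, Real.norm_of_nonneg (by positivity)]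
    by_cases hz : R⁻¹ * ‖z‖ ∈ S
    · rw [Set.indicator_of_mem (by simpa only [Set.mem_ofPred_eq, e1] using hz),
        Set.indicator_of_mem (by simpa using hz)]
      rw [enorm_smul, ← ofReal_norm, Real.norm_of_nonneg (by positivity : 0 ≤ R⁻¹),
        ENNReal.ofReal_inv_of_pos hR, ENNReal.mul_rpow_of_ne_top (by simpa using hR) (by simp),
        ENNReal.inv_rpow, ENNReal.rpow_neg, inv_inv]
    · rw [Set.indicator_of_notMem (by simpa only [Set.mem_ofPred_eq, e1] using hz),
        Set.indicator_of_notMem (by simpa using hz), mul_zero]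
  simp_rw [h2] at h
  rw [lintegral_const_mul' _ _ (by simp [hR0])] at h
  rw [ENNReal.rpow_sub _ _ hR0 (by simp), mul_comm _ (_ / _), ENNReal.div_eq_inv_mul,
    mul_assoc, ← h, ← mul_assoc, ENNReal.inv_mul_cancel, one_mul]
  · simp [hR0]
  · simp [hR0]

lemma hls_ball (d : ℕ) (hd : 1 ≤ d) (γ : ℝ) (hγd : γ < d) :
    ∫⁻ z : EuclideanSpace ℝ (Fin d), {z | ‖z‖ ∈ Set.Iio 1}.indicator (fun z => ‖z‖ₑ ^ (-γ)) z
      < ⊤ := by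
  have : Nontrivial (EuclideanSpace ℝ (Fin d)) := by
    apply Module.nontrivial_of_finrank_pos (R := ℝ); rw [finrank_euclideanSpace_fin]; omega
  have h := integrableOn_ball_of_norm_le_rpow (E := EuclideanSpace ℝ (Fin d)) (μ := volume)
    (by simpa using hd) (f := fun x => ‖x‖ ^ (-γ)) (C := 1) (α := γ) (r := 1)
    (by simpa using hγd) (ae_of_all _ fun x => by
      rw [one_mul, Real.norm_of_nonneg (by positivity)])
    (Measurable.aestronglyMeasurable (by fun_prop))
  have h3 := h.2
  rw [HasFiniteIntegral, ← lintegral_indicator measurableSet_ball] at h3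
  refine lt_of_eq_of_lt (lintegral_congr_ae ?_) h3
  have : ∀ᵐ z : EuclideanSpace ℝ (Fin d), z ≠ 0 := by
    simp [ae_iff]
  filter_upwards [this] with z hz
  have e : {z : EuclideanSpace ℝ (Fin d) | ‖z‖ ∈ Set.Iio (1:ℝ)} = Metric.ball 0 1 := by
    ext; simp
  rw [e]
  by_cases hz1 : z ∈ Metric.ball (0 : EuclideanSpace ℝ (Fin d)) 1
  · rw [Set.indicator_of_mem hz1, Set.indicator_of_mem hz1, ← ofReal_norm,
      ENNReal.ofReal_rpow_of_pos (by simpa using hz), Real.enorm_of_nonneg (by positivity)]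
  · simp [hz1]

lemma hls_tail (d : ℕ) (s : ℝ) (hs : d < s) :
    ∫⁻ z : EuclideanSpace ℝ (Fin d), {z | ‖z‖ ∈ Set.Ici 1}.indicator (fun z => ‖z‖ₑ ^ (-s)) z
      < ⊤ := by
  have h := finite_integral_one_add_norm (E := EuclideanSpace ℝ (Fin d)) (μ := volume) (r := s)
    (by simpa using hs)
  have hs0 : 0 < s := lt_of_le_of_lt (by positivity) hs
  refine lt_of_le_of_lt (lintegral_mono (g := fun z => ENNReal.ofReal (2 ^ s) *
    ENNReal.ofReal ((1 + ‖z‖) ^ (-s))) fun z => ?_) ?_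
  · beta_reduce
    by_cases hz : 1 ≤ ‖z‖
    · rw [Set.indicator_of_mem (by simpa using hz), ← ENNReal.ofReal_mul (by positivity),
        ← ofReal_norm, ENNReal.ofReal_rpow_of_pos (by linarith)]
      apply ENNReal.ofReal_le_ofReal
      have : ‖z‖ ^ (-s) = 2 ^ s * (2 * ‖z‖) ^ (-s) := by
        rw [Real.mul_rpow (by norm_num) (by positivity), ← mul_assoc, ← Real.rpow_add (by norm_num)]
        simp
      rw [this]
      refine mul_le_mul_of_nonneg_left ?_ (by positivity)
      exact Real.rpow_le_rpow_of_nonpos (by positivity) (by linarith) (by linarith)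
    · rw [Set.indicator_of_notMem (by simpa using hz)]
      positivity
  · rw [lintegral_const_mul' _ _ (by simp)]
    exact ENNReal.mul_lt_top (by simp) h

lemma hls_key (d : ℕ) (hd : 1 ≤ d) (γ : ℝ) (hγ0 : 0 < γ) (hγd : γ < d) (p : ℝ)
    (hp : p = 2 * d / (2 * d - γ)) :
    ∃ C : ℝ≥0∞, C ≠ ⊤ ∧ ∀ (x : EuclideanSpace ℝ (Fin d)) (g : EuclideanSpace ℝ (Fin d) → ℝ≥0∞),
      Measurable g → ∫⁻ y, g y ^ p ≤ 1 → ∀ a : ℝ≥0∞,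
      ∫⁻ y, {y | g y ≤ a}.indicator (fun y => g y * ‖x - y‖ₑ ^ (-γ)) y ≤ C * a ^ (p - 1) := by
  have hd0 : (0 : ℝ) < d := by exact_mod_cast hd
  have h2 : 0 < 2 * d - γ := by linarith
  have hp1 : p - 1 = γ / (2 * d - γ) := by rw [hp]; field_simp; ring
  have hp1' : 0 < p - 1 := by rw [hp1]; positivity
  set q : ℝ := 2 * d / γ with hq
  have hq0 : 0 < q := by positivity
  have hpq : p.HolderConjugate q := by
    rw [Real.holderConjugate_iff]
    refine ⟨by linarith, ?_⟩
    rw [hp, hq]; field_simp; ring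
  obtain ⟨C1, hC1⟩ : ∃ C1, C1 = ∫⁻ z : EuclideanSpace ℝ (Fin d),
    {z | ‖z‖ ∈ Set.Iio 1}.indicator (fun z => ‖z‖ₑ ^ (-γ)) z := ⟨_, rfl⟩
  obtain ⟨C2, hC2⟩ : ∃ C2, C2 = ∫⁻ z : EuclideanSpace ℝ (Fin d),
    {z | ‖z‖ ∈ Set.Ici 1}.indicator (fun z => ‖z‖ₑ ^ (-(2 * d : ℝ))) z := ⟨_, rfl⟩
  have hC1t : C1 ≠ ⊤ := by rw [hC1]; exact (hls_ball d hd γ hγd).ne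
  have hC2t : C2 ≠ ⊤ := by rw [hC2]; exact (hls_tail d (2 * d) (by linarith)).ne
  have hC2q : C2 ^ (1 / q) ≠ ⊤ := ENNReal.rpow_ne_top_of_nonneg (by positivity) hC2t
  refine ⟨C1 + C2 ^ (1 / q) + 1, ENNReal.add_ne_top.2 ⟨ENNReal.add_ne_top.2 ⟨hC1t, hC2q⟩, by simp⟩, fun x g hg hg1 a => ?_⟩
  rcases eq_or_ne a 0 with rfl | ha0
  · refine le_of_eq_of_le ?_ zero_le
    rw [lintegral_eq_zero_iff' ]
    · refine ae_of_all _ fun y => ?_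
      by_cases hy : g y = 0
      · simp [Set.indicator, hy]
      · simp [Set.indicator, hy]
    · exact (Measurable.indicator (by fun_prop)
        (measurableSet_le hg measurable_const)).aemeasurable
  rcases eq_or_ne a ⊤ with rfl | hat
  · rw [ENNReal.top_rpow_of_pos hp1', ENNReal.mul_top (by simp)]
    exact le_top
  set α := a.toReal with hα
  have hα0 : 0 < α := ENNReal.toReal_pos ha0 hat
  have haα : ENNReal.ofReal α = a := ENNReal.ofReal_toReal hat
  set R : ℝ := α ^ (-p / d) with hR
  have hR0 : 0 < R := by positivity
  have hRs : ∀ s : ℝ, ENNReal.ofReal R ^ s = a ^ (-p / d * s) := by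
    intro s
    rw [hR, ← ENNReal.ofReal_rpow_of_pos hα0, haα, ENNReal.rpow_mul]
  let k1 : EuclideanSpace ℝ (Fin d) → ℝ≥0∞ :=
    {z | R⁻¹ * ‖z‖ ∈ Set.Iio 1}.indicator (fun z => ‖z‖ₑ ^ (-γ))
  let k2 : EuclideanSpace ℝ (Fin d) → ℝ≥0∞ :=
    {z | R⁻¹ * ‖z‖ ∈ Set.Ici 1}.indicator (fun z => ‖z‖ₑ ^ (-γ))
  have hmn : Measurable fun z : EuclideanSpace ℝ (Fin d) => R⁻¹ * ‖z‖ := by fun_prop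
  have hk1 : Measurable k1 := Measurable.indicator (by fun_prop) (hmn measurableSet_Iio)
  have hk2 : Measurable k2 := Measurable.indicator (by fun_prop) (hmn measurableSet_Ici)
  have hpt : ∀ y, {y | g y ≤ a}.indicator (fun y => g y * ‖x - y‖ₑ ^ (-γ)) y
      ≤ a * k1 (x - y) + g y * k2 (x - y) := by
    intro y
    by_cases hy : g y ≤ a
    · rw [Set.indicator_of_mem (by exact hy)]
      by_cases hxy : R⁻¹ * ‖x - y‖ < 1
      · have : k1 (x - y) = ‖x - y‖ₑ ^ (-γ) := Set.indicator_of_mem (by exact hxy) _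
        rw [this]
        exact le_add_right (by gcongr)
      · have : k2 (x - y) = ‖x - y‖ₑ ^ (-γ) := Set.indicator_of_mem (by exact not_lt.1 hxy) _
        rw [this]
        exact le_add_left le_rfl
    · rw [Set.indicator_of_notMem (by exact hy)]
      exact zero_le
  have hi1 : ∫⁻ y, a * k1 (x - y) = C1 * a ^ (p - 1) := by
    rw [lintegral_const_mul' _ _ hat, lintegral_sub_left_eq_self,
      hls_power_scale d γ _ measurableSet_Iio hR0, ← hC1, hRs, mul_left_comm]
    congr 1
    nth_rewrite 1 [← ENNReal.rpow_one a]
    rw [← ENNReal.rpow_add _ _ ha0 hat, hp1]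
    congr 1
    rw [hp]; field_simp; ring
  have hi2 : ∫⁻ y, g y * k2 (x - y) ≤ C2 ^ (1 / q) * a ^ (p - 1) := by
    have h := ENNReal.lintegral_mul_le_Lp_mul_Lq volume hpq (f := g) (g := fun y => k2 (x - y))
      hg.aemeasurable (by fun_prop)
    refine h.trans ?_
    have e : ∀ z, k2 z ^ q = {z : EuclideanSpace ℝ (Fin d) | R⁻¹ * ‖z‖ ∈ Set.Ici 1}.indicator
        (fun z => ‖z‖ₑ ^ (-(2 * d : ℝ))) z := by
      intro z
      by_cases hz : R⁻¹ * ‖z‖ ∈ Set.Ici 1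
      · rw [Set.indicator_of_mem (by exact hz)]
        have : k2 z = ‖z‖ₑ ^ (-γ) := Set.indicator_of_mem (by exact hz) _
        rw [this, ← ENNReal.rpow_mul, hq]
        congr 1
        field_simp
      · rw [Set.indicator_of_notMem (by exact hz)]
        have : k2 z = 0 := Set.indicator_of_notMem (by exact hz) _
        rw [this, ENNReal.zero_rpow_of_pos hq0]
    have e2 : ∫⁻ y, k2 (x - y) ^ q = C2 * a ^ (-p / d * (d - 2 * d)) := by
      rw [lintegral_sub_left_eq_self (fun z => k2 z ^ q)]
      simp_rw [e]
      rw [hls_power_scale d (2 * d) _ measurableSet_Ici hR0, ← hC2, hRs]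
    rw [e2, ENNReal.mul_rpow_of_nonneg _ _ (by positivity), ← ENNReal.rpow_mul]
    have e3 : -p / d * (d - 2 * d) * (1 / q) = p - 1 := by
      rw [hp1, hp, hq]; field_simp; ring
    rw [e3]
    exact mul_le_of_le_one_left zero_le
      (ENNReal.rpow_le_one hg1 (by have := hpq.pos; positivity))
  calc _ ≤ ∫⁻ y, (a * k1 (x - y) + g y * k2 (x - y)) := lintegral_mono hpt
    _ = (∫⁻ y, a * k1 (x - y)) + ∫⁻ y, g y * k2 (x - y) := by
      rw [lintegral_add_left (by fun_prop)]
    _ ≤ C1 * a ^ (p - 1) + C2 ^ (1 / q) * a ^ (p - 1) := add_le_add hi1.le hi2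
    _ ≤ _ := by rw [← add_mul]; exact mul_le_mul_left le_self_add _

lemma hls_bilinear (d : ℕ) (hd : 1 ≤ d) (γ : ℝ) (hγ0 : 0 < γ) (hγd : γ < d) (p : ℝ)
    (hp : p = 2 * d / (2 * d - γ)) :
    ∃ C : ℝ≥0∞, C ≠ ⊤ ∧ ∀ (f g : EuclideanSpace ℝ (Fin d) → ℝ≥0∞),
      Measurable f → Measurable g → ∫⁻ y, f y ^ p ≤ 1 → ∫⁻ y, g y ^ p ≤ 1 →
      ∫⁻ x, f x * ∫⁻ y, g y * ‖x - y‖ₑ ^ (-γ) ≤ C := by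
  obtain ⟨C, hC, hkey⟩ := hls_key d hd γ hγ0 hγd p hp
  refine ⟨C + C, by simp [hC], fun f g hf hg hf1 hg1 => ?_⟩
  have hd0 : (0 : ℝ) < d := by exact_mod_cast hd
  have h2 : 0 < 2 * d - γ := by linarith
  have hp1 : p - 1 = γ / (2 * d - γ) := by rw [hp]; field_simp; ring
  have hp1' : 0 < p - 1 := by rw [hp1]; positivity
  have hpow : ∀ a : ℝ≥0∞, a * (C * a ^ (p - 1)) = C * a ^ p := by
    intro a
    rw [mul_left_comm]
    congr 1
    nth_rewrite 1 [← ENNReal.rpow_one a]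
    rw [← ENNReal.rpow_add_of_nonneg _ _ zero_le_one hp1'.le]
    congr 1; ring
  let F : EuclideanSpace ℝ (Fin d) × EuclideanSpace ℝ (Fin d) → ℝ≥0∞ :=
    {z | g z.2 ≤ f z.1}.indicator (fun z => f z.1 * (g z.2 * ‖z.1 - z.2‖ₑ ^ (-γ)))
  let G : EuclideanSpace ℝ (Fin d) × EuclideanSpace ℝ (Fin d) → ℝ≥0∞ :=
    {z | f z.1 ≤ g z.2}.indicator (fun z => g z.2 * (f z.1 * ‖z.2 - z.1‖ₑ ^ (-γ)))
  have hF : Measurable F := Measurable.indicator (by fun_prop)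
    (measurableSet_le (by fun_prop) (by fun_prop))
  have hG : Measurable G := Measurable.indicator (by fun_prop)
    (measurableSet_le (by fun_prop) (by fun_prop))
  have hpt : ∀ x y, f x * (g y * ‖x - y‖ₑ ^ (-γ)) ≤ F (x, y) + G (x, y) := by
    intro x y
    rcases le_total (g y) (f x) with h | h
    · have : F (x, y) = f x * (g y * ‖x - y‖ₑ ^ (-γ)) := Set.indicator_of_mem (by exact h) _
      rw [this]; exact le_self_add
    · have : G (x, y) = g y * (f x * ‖y - x‖ₑ ^ (-γ)) := Set.indicator_of_mem (by exact h) _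
      rw [this, mul_left_comm, enorm_sub_rev]; exact le_add_self
  have hFi : ∫⁻ x, ∫⁻ y, F (x, y) ≤ C := by
    calc _ ≤ ∫⁻ x, C * f x ^ p := by
          refine lintegral_mono fun x => ?_
          have e : ∀ y, F (x, y) =
              f x * {y | g y ≤ f x}.indicator (fun y => g y * ‖x - y‖ₑ ^ (-γ)) y := by
            intro y
            by_cases h : g y ≤ f x
            · rw [Set.indicator_of_mem (by exact h)]
              exact Set.indicator_of_mem (by exact h) _
            · rw [Set.indicator_of_notMem (by exact h), mul_zero]
              exact Set.indicator_of_notMem (by exact h) _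
          simp_rw [e]
          rw [lintegral_const_mul _ (Measurable.indicator (by fun_prop)
            (measurableSet_le hg measurable_const)), ← hpow]
          gcongr
          exact hkey x g hg hg1 (f x)
      _ = C * ∫⁻ x, f x ^ p := lintegral_const_mul _ (by fun_prop)
      _ ≤ C * 1 := by gcongr
      _ = C := mul_one _
  have hGi : ∫⁻ x, ∫⁻ y, G (x, y) ≤ C := by
    rw [lintegral_lintegral_swap (f := fun x y => G (x, y)) hG.aemeasurable]
    calc _ ≤ ∫⁻ y, C * g y ^ p := by
          refine lintegral_mono fun y => ?_
          have e : ∀ x, G (x, y) =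
              g y * {x | f x ≤ g y}.indicator (fun x => f x * ‖y - x‖ₑ ^ (-γ)) x := by
            intro x
            by_cases h : f x ≤ g y
            · rw [Set.indicator_of_mem (by exact h)]
              exact Set.indicator_of_mem (by exact h) _
            · rw [Set.indicator_of_notMem (by exact h), mul_zero]
              exact Set.indicator_of_notMem (by exact h) _
          simp_rw [e]
          rw [lintegral_const_mul _ (Measurable.indicator (by fun_prop)
            (measurableSet_le hf measurable_const)), ← hpow]
          gcongr
          exact hkey y f hf hf1 (g y)
      _ = C * ∫⁻ x, g x ^ p := lintegral_const_mul _ (by fun_prop)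
      _ ≤ C * 1 := by gcongr
      _ = C := mul_one _
  calc _ = ∫⁻ x, ∫⁻ y, f x * (g y * ‖x - y‖ₑ ^ (-γ)) := by
        refine lintegral_congr fun x => ?_
        rw [lintegral_const_mul _ (by fun_prop)]
    _ ≤ ∫⁻ x, ∫⁻ y, (F (x, y) + G (x, y)) :=
        lintegral_mono fun x => lintegral_mono fun y => hpt x y
    _ = ∫⁻ x, ((∫⁻ y, F (x, y)) + ∫⁻ y, G (x, y)) := by
        refine lintegral_congr fun x => ?_
        rw [lintegral_add_left (by fun_prop)]
    _ = (∫⁻ x, ∫⁻ y, F (x, y)) + ∫⁻ x, ∫⁻ y, G (x, y) := by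
        rw [lintegral_add_left (hF.lintegral_prod_right')]
    _ ≤ C + C := add_le_add hFi hGi

/-- The Riesz potential of an extended-nonnegative function. -/
def hlsI (d : ℕ) (γ : ℝ) (f : EuclideanSpace ℝ (Fin d) → ℝ≥0∞) (x : EuclideanSpace ℝ (Fin d)) :
    ℝ≥0∞ := ∫⁻ y, f y * ‖x - y‖ₑ ^ (-γ)

lemma measurable_hlsI (d : ℕ) (γ : ℝ) {f : EuclideanSpace ℝ (Fin d) → ℝ≥0∞} (hf : Measurable f) :
    Measurable (hlsI d γ f) := by
  have : Measurable fun z : EuclideanSpace ℝ (Fin d) × EuclideanSpace ℝ (Fin d) =>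
    f z.2 * ‖z.1 - z.2‖ₑ ^ (-γ) := by fun_prop
  exact this.lintegral_prod_right'

open Filter Topology in
lemma hls_normalized (d : ℕ) (hd : 1 ≤ d) (γ : ℝ) (hγ0 : 0 < γ) (hγd : γ < d) (p q : ℝ)
    (hp : p = 2 * d / (2 * d - γ)) (hpq : p.HolderConjugate q) :
    ∃ C : ℝ≥0∞, C ≠ ⊤ ∧ ∀ (f : EuclideanSpace ℝ (Fin d) → ℝ≥0∞),
      Measurable f → ∫⁻ y, f y ^ p ≤ 1 → ∫⁻ x, hlsI d γ f x ^ q ≤ C ^ q := by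
  obtain ⟨C, hC, hB⟩ := hls_bilinear d hd γ hγ0 hγd p hp
  refine ⟨C, hC, fun f hf hf1 => ?_⟩
  have hq0 : 0 < q := hpq.symm.pos
  have hp0 : 0 < p := hpq.pos
  have hm := measurable_hlsI d γ hf
  let h : ℕ → EuclideanSpace ℝ (Fin d) → ℝ≥0∞ := fun n =>
    (Metric.ball 0 (n : ℝ)).indicator (fun x => min (hlsI d γ f x) n)
  have hh : ∀ n, Measurable (h n) := fun n =>
    Measurable.indicator (by fun_prop) measurableSet_ball
  have hle : ∀ n x, h n x ≤ hlsI d γ f x := by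
    intro n x
    by_cases hx : x ∈ Metric.ball (0 : EuclideanSpace ℝ (Fin d)) (n : ℝ)
    · simp only [h, Set.indicator_of_mem hx]; exact min_le_left _ _
    · simp only [h, Set.indicator_of_notMem hx]; exact zero_le
  have hA : ∀ n, ∫⁻ x, h n x ^ q ≤ C ^ q := by
    intro n
    obtain ⟨A, hAd⟩ : ∃ A, A = ∫⁻ x, h n x ^ q := ⟨_, rfl⟩
    rw [← hAd]
    have hAt : A ≠ ⊤ := by
      rw [hAd]
      refine (lt_of_le_of_lt (lintegral_mono (g := (Metric.ball 0 (n : ℝ)).indicator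
        (fun x => (n : ℝ≥0∞) ^ q)) fun x => ?_) ?_).ne
      · by_cases hx : x ∈ Metric.ball (0 : EuclideanSpace ℝ (Fin d)) (n : ℝ)
        · simp only [h, Set.indicator_of_mem hx]
          gcongr
          exact min_le_right _ _
        · simp only [h, Set.indicator_of_notMem hx, ENNReal.zero_rpow_of_pos hq0]
          exact le_rfl
      · rw [lintegral_indicator measurableSet_ball, setLIntegral_const]
        exact ENNReal.mul_lt_top (ENNReal.rpow_lt_top_of_nonneg hq0.le (by simp))
          measure_ball_lt_top
    rcases eq_or_ne A 0 with hA0 | hA0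
    · rw [hA0]; exact zero_le
    have hcn : A ^ (-(1 / p)) ≠ ⊤ := by
      simp [ENNReal.rpow_eq_top_iff, hA0, hAt]
    have hqp : (q - 1) * p = q := by
      have := hpq.sub_one_mul_conj
      have := hpq.mul_eq_add
      linarith
    have hg1 : ∫⁻ x, (A ^ (-(1 / p)) * h n x ^ (q - 1)) ^ p ≤ 1 := by
      have e : ∀ x, (A ^ (-(1 / p)) * h n x ^ (q - 1)) ^ p = A⁻¹ * h n x ^ q := by
        intro x
        rw [ENNReal.mul_rpow_of_nonneg _ _ hp0.le, ← ENNReal.rpow_mul, ← ENNReal.rpow_mul, hqp]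
        congr 1
        rw [← ENNReal.rpow_neg_one]; congr 1; field_simp
      simp_rw [e]
      rw [lintegral_const_mul' _ _ (by simpa using hA0), ← hAd, ENNReal.inv_mul_cancel hA0 hAt]
    have hb := hB (fun x => A ^ (-(1 / p)) * h n x ^ (q - 1)) f (by fun_prop) hf hg1 hf1
    have hA2 : A ^ (1 / q) ≤ C := by
      refine le_trans ?_ hb
      calc A ^ (1 / q) = A ^ (-(1 / p)) * A := by
            nth_rewrite 3 [← ENNReal.rpow_one A]
            rw [← ENNReal.rpow_add _ _ hA0 hAt]
            congr 1
            have := hpq.inv_add_inv_eq_one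
            simp only [one_div]; linarith
        _ = ∫⁻ x, A ^ (-(1 / p)) * h n x ^ q := by rw [lintegral_const_mul' _ _ hcn, ← hAd]
        _ ≤ _ := by
            refine lintegral_mono fun x => ?_
            dsimp only
            rw [mul_assoc]
            gcongr
            calc h n x ^ q = h n x ^ (q - 1) * h n x := by
                  nth_rewrite 3 [← ENNReal.rpow_one (h n x)]
                  rw [← ENNReal.rpow_add_of_nonneg _ _ hpq.symm.sub_one_pos.le zero_le_one]
                  congr 1; ring
              _ ≤ _ := by gcongr; exact hle n x
    calc A = (A ^ (1 / q)) ^ q := by rw [← ENNReal.rpow_mul, one_div_mul_cancel hq0.ne',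
                ENNReal.rpow_one]
      _ ≤ _ := by gcongr
  have hlim := lintegral_tendsto_of_tendsto_of_monotone (μ := volume)
    (f := fun n x => h n x ^ q) (F := fun x => hlsI d γ f x ^ q)
    (fun n => by fun_prop) ?_ ?_
  · exact le_of_tendsto' hlim hA
  · refine ae_of_all _ fun x m n hmn => ?_
    dsimp only
    gcongr
    by_cases hx : x ∈ Metric.ball (0 : EuclideanSpace ℝ (Fin d)) (m : ℝ)
    · have hx' : x ∈ Metric.ball (0 : EuclideanSpace ℝ (Fin d)) (n : ℝ) :=
        Metric.ball_subset_ball (by exact_mod_cast hmn) hx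
      simp only [h, Set.indicator_of_mem hx, Set.indicator_of_mem hx']
      gcongr
    · simp only [h, Set.indicator_of_notMem hx]; exact zero_le
  · refine ae_of_all _ fun x => ?_
    refine ((ENNReal.continuous_rpow_const (y := q)).tendsto _).comp ?_
    have h1 : Tendsto (fun n : ℕ => min (hlsI d γ f x) n) atTop (𝓝 (hlsI d γ f x)) := by
      have := (tendsto_const_nhds (x := hlsI d γ f x)).min ENNReal.tendsto_nat_nhds_top
      simpa using this
    refine h1.congr' ?_
    obtain ⟨N, hN⟩ := exists_nat_gt ‖x‖
    filter_upwards [eventually_ge_atTop N] with n hn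
    have hx : x ∈ Metric.ball (0 : EuclideanSpace ℝ (Fin d)) (n : ℝ) := by
      have : (N : ℝ) ≤ n := by exact_mod_cast hn
      simp; linarith
    simp only [h, Set.indicator_of_mem hx]

lemma hls_main (d : ℕ) (hd : 1 ≤ d) (γ : ℝ) (hγ0 : 0 < γ) (hγd : γ < d) (p q : ℝ)
    (hp : p = 2 * d / (2 * d - γ)) (hpq : p.HolderConjugate q) :
    ∃ C : ℝ≥0∞, C ≠ ⊤ ∧ ∀ (f : EuclideanSpace ℝ (Fin d) → ℝ≥0∞), Measurable f →
      (∫⁻ x, hlsI d γ f x ^ q) ^ (1 / q) ≤ C * (∫⁻ y, f y ^ p) ^ (1 / p) := by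
  obtain ⟨C, hC, hN⟩ := hls_normalized d hd γ hγ0 hγd p q hp hpq
  refine ⟨C + 1, by simp [hC], fun f hf => ?_⟩
  have hq0 : 0 < q := hpq.symm.pos
  have hp0 : 0 < p := hpq.pos
  obtain ⟨N, hNd⟩ : ∃ N, N = (∫⁻ y, f y ^ p) ^ (1 / p) := ⟨_, rfl⟩
  have hNp : N ^ p = ∫⁻ y, f y ^ p := by
    rw [hNd, ← ENNReal.rpow_mul, one_div_mul_cancel hp0.ne', ENNReal.rpow_one]
  rw [← hNd]
  rcases eq_or_ne N ⊤ with hNt | hNt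
  · rw [hNt, ENNReal.mul_top (by simp)]; exact le_top
  rcases eq_or_ne N 0 with hN0 | hN0
  · rw [hN0, ENNReal.zero_rpow_of_pos hp0, eq_comm, lintegral_eq_zero_iff (by fun_prop)] at hNp
    have hI : ∀ x, hlsI d γ f x = 0 := by
      intro x
      rw [hlsI, lintegral_eq_zero_iff (by fun_prop)]
      filter_upwards [hNp] with y hy
      have : f y = 0 := by simpa [hp0, hp0.not_gt] using hy
      simp [this]
    simp [hI, hq0]
  have hN1 : ∫⁻ y, (N⁻¹ * f y) ^ p ≤ 1 := by
    simp_rw [ENNReal.mul_rpow_of_nonneg _ _ hp0.le]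
    rw [lintegral_const_mul _ (by fun_prop), ← hNp, ENNReal.inv_rpow, ENNReal.inv_mul_cancel]
    · simp [hN0, hNt]
    · simp [hN0, hNt, hp0.le]
  have h1 := hN (fun y => N⁻¹ * f y) (by fun_prop) hN1
  have e : ∀ x, hlsI d γ f x = N * hlsI d γ (fun y => N⁻¹ * f y) x := by
    intro x
    simp only [hlsI, mul_assoc]
    rw [lintegral_const_mul _ (by fun_prop), ← mul_assoc, ENNReal.mul_inv_cancel hN0 hNt, one_mul]
  have hm := measurable_hlsI d γ (f := fun y => N⁻¹ * f y) (by fun_prop)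
  simp_rw [e, ENNReal.mul_rpow_of_nonneg _ _ hq0.le]
  rw [lintegral_const_mul _ (by fun_prop)]
  calc _ ≤ (N ^ q * C ^ q) ^ (1 / q) := by gcongr
    _ = N * C := by
      rw [← ENNReal.mul_rpow_of_nonneg _ _ hq0.le, ← ENNReal.rpow_mul,
        mul_one_div_cancel hq0.ne', ENNReal.rpow_one]
    _ ≤ _ := by rw [mul_comm]; exact mul_le_mul_left le_self_add _

lemma schwartz_decay_bound {d : ℕ} {F : Type*} [NormedAddCommGroup F] [NormedSpace ℝ F]
    (ψ : SchwartzMap (EuclideanSpace ℝ (Fin d)) F) :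
    ∃ C : ℝ, 0 ≤ C ∧ ∀ x, ‖ψ x‖ ≤ C * (1 + ‖x‖) ^ (-(d + 1 : ℝ)) := by
  have h := fun x => SchwartzMap.one_add_le_sup_seminorm_apply (𝕜 := ℝ) (m := (d + 1, 0))
    (k := d + 1) (n := 0) le_rfl le_rfl ψ x
  simp only [norm_iteratedFDeriv_zero] at h
  refine ⟨_, le_trans (by positivity) (h 0), fun x => ?_⟩
  have hx := h x
  have e : (1 + ‖x‖) ^ (-(d + 1 : ℝ)) = ((1 + ‖x‖) ^ (d + 1))⁻¹ := by
    rw [Real.rpow_neg (by positivity)]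
    congr 1
    exact_mod_cast Real.rpow_natCast (1 + ‖x‖) (d + 1)
  rw [e, ← div_eq_mul_inv, le_div_iff₀ (by positivity), mul_comm]
  exact hx

lemma kernel_integrable (d : ℕ) (hd : 1 ≤ d) (γ : ℝ) (hγ0 : 0 < γ) (hγd : γ < d) :
    Integrable (fun z : EuclideanSpace ℝ (Fin d) =>
      ‖z‖ ^ (-γ) * (1 + ‖z‖) ^ (-(d + 1 : ℝ))) := by
  have h1 := integrableOn_ball_of_norm_le_rpow (E := EuclideanSpace ℝ (Fin d)) (μ := volume)
    (by simpa using hd) (f := fun x => ‖x‖ ^ (-γ)) (C := 1) (α := γ) (r := 1)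
    (by simpa using hγd) (ae_of_all _ fun x => by
      rw [one_mul, Real.norm_of_nonneg (by positivity)])
    (Measurable.aestronglyMeasurable (by fun_prop))
  rw [← integrable_indicator_iff measurableSet_ball] at h1
  have h2 := integrable_one_add_norm (E := EuclideanSpace ℝ (Fin d)) (μ := volume)
    (r := d + 1) (by simp)
  refine (h1.add h2).mono' (Measurable.aestronglyMeasurable (by fun_prop))
    (ae_of_all _ fun z => ?_)
  rw [Real.norm_of_nonneg (by positivity), Pi.add_apply]
  by_cases hz : z ∈ Metric.ball (0 : EuclideanSpace ℝ (Fin d)) 1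
  · rw [Set.indicator_of_mem hz]
    have : (1 + ‖z‖) ^ (-(d + 1 : ℝ)) ≤ 1 :=
      Real.rpow_le_one_of_one_le_of_nonpos (by simp) (by linarith [(Nat.cast_nonneg d : (0:ℝ) ≤ d)])
    have h3 : 0 ≤ (1 + ‖z‖) ^ (-(d + 1 : ℝ)) := by positivity
    have h4 : 0 ≤ ‖z‖ ^ (-γ) := by positivity
    nlinarith
  · rw [Set.indicator_of_notMem hz, zero_add]
    have hz1 : 1 ≤ ‖z‖ := by simpa using hz
    have : ‖z‖ ^ (-γ) ≤ 1 := Real.rpow_le_one_of_one_le_of_nonpos hz1 (by linarith)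
    exact mul_le_of_le_one_left (by positivity) this

lemma one_add_shift {d : ℕ} (x₀ x z : EuclideanSpace ℝ (Fin d)) (hx : x ∈ Metric.ball x₀ 1) :
    (1 + ‖x - z‖) ^ (-(d + 1 : ℝ)) ≤
      (2 + ‖x₀‖) ^ (d + 1 : ℝ) * (1 + ‖z‖) ^ (-(d + 1 : ℝ)) := by
  have h1 : ‖x - x₀‖ < 1 := by simpa [dist_eq_norm] using hx
  have h2 : ‖z‖ ≤ ‖x - z‖ + ‖x - x₀‖ + ‖x₀‖ := by
    calc ‖z‖ = ‖-(x - z) + (x - x₀) + x₀‖ := by congr 1; abel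
      _ ≤ ‖-(x - z)‖ + ‖x - x₀‖ + ‖x₀‖ := norm_add₃_le
      _ = _ := by rw [norm_neg]
  have h3 : (1 + ‖z‖) / (2 + ‖x₀‖) ≤ 1 + ‖x - z‖ := by
    rw [div_le_iff₀ (by positivity)]
    nlinarith [norm_nonneg (x - z), norm_nonneg x₀]
  calc (1 + ‖x - z‖) ^ (-(d + 1 : ℝ)) ≤ ((1 + ‖z‖) / (2 + ‖x₀‖)) ^ (-(d + 1 : ℝ)) :=
        Real.rpow_le_rpow_of_nonpos (by positivity) h3
          (by linarith [(Nat.cast_nonneg d : (0:ℝ) ≤ d)])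
    _ = _ := by
      rw [Real.div_rpow (by positivity) (by positivity), Real.rpow_neg (x := 2 + ‖x₀‖)
        (by positivity), div_inv_eq_mul, mul_comm]

lemma riesz_integrable {d : ℕ} (hd : 1 ≤ d) {γ : ℝ} (hγ0 : 0 < γ) (hγd : γ < d)
    {F : Type*} [NormedAddCommGroup F] [NormedSpace ℝ F]
    (ψ : SchwartzMap (EuclideanSpace ℝ (Fin d)) F) (x : EuclideanSpace ℝ (Fin d)) :
    Integrable (fun z => ‖z‖ ^ (-γ) • ψ (x - z)) := by
  obtain ⟨C, hC, hψ⟩ := schwartz_decay_bound ψ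
  refine ((kernel_integrable d hd γ hγ0 hγd).const_mul (C * (2 + ‖x‖) ^ (d + 1 : ℝ))).mono' ?_
    (ae_of_all _ fun z => ?_)
  · refine AEStronglyMeasurable.smul (Measurable.aestronglyMeasurable (by fun_prop)) ?_
    exact (ψ.continuous.comp (by fun_prop)).aestronglyMeasurable
  · rw [norm_smul, Real.norm_of_nonneg (by positivity)]
    have h1 := hψ (x - z)
    have h2 := one_add_shift x x z (by simp)
    calc _ ≤ ‖z‖ ^ (-γ) * (C * ((2 + ‖x‖) ^ (d + 1 : ℝ) * (1 + ‖z‖) ^ (-(d + 1 : ℝ)))) := by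
          gcongr
          exact h1.trans (by gcongr)
      _ = _ := by ring

lemma riesz_hasFDerivAt {d : ℕ} (hd : 1 ≤ d) {γ : ℝ} (hγ0 : 0 < γ) (hγd : γ < d)
    (φ : SchwartzMap (EuclideanSpace ℝ (Fin d)) ℂ) (x₀ : EuclideanSpace ℝ (Fin d)) :
    HasFDerivAt (fun x => ∫ y, ((‖x - y‖ ^ (-γ) : ℝ) : ℂ) * φ y)
      (∫ z, ‖z‖ ^ (-γ) • fderiv ℝ φ (x₀ - z)) x₀ := by
  have e : (fun x => ∫ y, ((‖x - y‖ ^ (-γ) : ℝ) : ℂ) * φ y) =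
      fun x => ∫ z, ‖z‖ ^ (-γ) • φ (x - z) := by
    ext x
    rw [← integral_sub_left_eq_self _ volume x]
    simp
  rw [e]
  obtain ⟨C, hC, hψ⟩ := schwartz_decay_bound (SchwartzMap.fderivCLM ℝ _ ℂ φ)
  have hi := riesz_integrable hd hγ0 hγd (SchwartzMap.fderivCLM ℝ _ ℂ φ) x₀
  simp only [SchwartzMap.fderivCLM_apply] at hψ hi
  refine hasFDerivAt_integral_of_dominated_of_fderiv_le (s := Metric.ball x₀ 1)
    (bound := fun z => (C * (2 + ‖x₀‖) ^ (d + 1 : ℝ)) *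
      (‖z‖ ^ (-γ) * (1 + ‖z‖) ^ (-(d + 1 : ℝ))))
    (F := fun x z => ‖z‖ ^ (-γ) • φ (x - z))
    (F' := fun x z => ‖z‖ ^ (-γ) • fderiv ℝ φ (x - z))
    (Metric.ball_mem_nhds _ one_pos)
    (Filter.Eventually.of_forall fun x => (riesz_integrable hd hγ0 hγd φ x).1)
    (riesz_integrable hd hγ0 hγd φ x₀) hi.1 (ae_of_all _ fun z x hx => ?_)
    ((kernel_integrable d hd γ hγ0 hγd).const_mul _) (ae_of_all _ fun z x hx => ?_)
  · rw [norm_smul, Real.norm_of_nonneg (by positivity)]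
    have h1 := hψ (x - z)
    have h2 := one_add_shift x₀ x z hx
    calc _ ≤ ‖z‖ ^ (-γ) * (C * ((2 + ‖x₀‖) ^ (d + 1 : ℝ) * (1 + ‖z‖) ^ (-(d + 1 : ℝ)))) := by
          gcongr
          exact h1.trans (by gcongr)
      _ = _ := by ring
  · have h1 : HasFDerivAt φ (fderiv ℝ φ (x - z)) (x - z) := φ.differentiableAt.hasFDerivAt
    have h2 : HasFDerivAt (fun x : EuclideanSpace ℝ (Fin d) => x - z)
      (ContinuousLinearMap.id ℝ _) x := (hasFDerivAt_id x).sub_const z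
    exact (h1.comp x h2).const_smul (‖z‖ ^ (-γ))

lemma riesz_enorm_le {d : ℕ} {γ : ℝ} (hγ0 : 0 < γ) {F : Type*} [NormedAddCommGroup F]
    [NormedSpace ℝ F] (ψ : EuclideanSpace ℝ (Fin d) → F) (x : EuclideanSpace ℝ (Fin d)) :
    ‖∫ z, ‖z‖ ^ (-γ) • ψ (x - z)‖ₑ ≤ hlsI d γ (fun y => ‖ψ y‖ₑ) x := by
  refine (enorm_integral_le_lintegral_enorm _).trans ?_
  rw [hlsI, ← lintegral_sub_left_eq_self _ x]
  refine lintegral_mono fun z => ?_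
  dsimp only
  rw [sub_sub_cancel, enorm_smul, mul_comm]
  gcongr
  by_cases hz : x - z = 0
  · rw [hz, enorm_zero, ENNReal.zero_rpow_of_neg (by linarith)]; exact le_top
  · rw [← ofReal_norm (x - z), ENNReal.ofReal_rpow_of_pos (by simpa using hz),
      Real.enorm_of_nonneg (by positivity)]

lemma hlsI_mono {d : ℕ} {γ : ℝ} {f g : EuclideanSpace ℝ (Fin d) → ℝ≥0∞} (h : ∀ y, f y ≤ g y)
    (x : EuclideanSpace ℝ (Fin d)) : hlsI d γ f x ≤ hlsI d γ g x :=
  lintegral_mono fun y => mul_le_mul_left (h y) _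

lemma hlsI_add {d : ℕ} {γ : ℝ} {f g : EuclideanSpace ℝ (Fin d) → ℝ≥0∞} (hf : Measurable f)
    (x : EuclideanSpace ℝ (Fin d)) :
    hlsI d γ (fun y => f y + g y) x = hlsI d γ f x + hlsI d γ g x := by
  simp only [hlsI, add_mul]
  rw [lintegral_add_left (by fun_prop)]

/-- The sesquilinear product `(z, w) ↦ z * conj w` as a real bilinear map. -/
def conjMulB : ℂ →L[ℝ] ℂ →L[ℝ] ℂ :=
  ((ContinuousLinearMap.mul ℝ ℂ).flip.comp (conjCLE : ℂ →L[ℝ] ℂ)).flip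

lemma conjMulB_apply (z w : ℂ) : conjMulB z w = z * (starRingEnd ℂ) w := by
  simp [conjMulB, mul_comm]

lemma hartreeT_deriv {d : ℕ} (hd : 1 ≤ d) {γ : ℝ} (hγ0 : 0 < γ) (hγd : γ < d)
    (u₁ u₂ u₃ : SchwartzMap (EuclideanSpace ℝ (Fin d)) ℂ) (x : EuclideanSpace ℝ (Fin d)) :
    DifferentiableAt ℝ (hartreeT d γ u₁ u₂ u₃) x ∧
      ‖fderiv ℝ (hartreeT d γ u₁ u₂ u₃) x‖ₑ ≤
        hlsI d γ (fun y => ‖fderiv ℝ u₁ y‖ₑ * ‖u₂ y‖ₑ) x * ‖u₃ x‖ₑ +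
        hlsI d γ (fun y => ‖u₁ y‖ₑ * ‖fderiv ℝ u₂ y‖ₑ) x * ‖u₃ x‖ₑ +
        hlsI d γ (fun y => ‖u₁ y‖ₑ * ‖u₂ y‖ₑ) x * ‖fderiv ℝ u₃ x‖ₑ := by
  let φ : SchwartzMap (EuclideanSpace ℝ (Fin d)) ℂ := SchwartzMap.pairing conjMulB u₁ u₂
  have hφ : ∀ y, φ y = u₁ y * (starRingEnd ℂ) (u₂ y) := fun y => by
    rw [← conjMulB_apply]; rfl
  have hφd : ∀ y, ‖fderiv ℝ φ y‖ₑ ≤ ‖fderiv ℝ u₁ y‖ₑ * ‖u₂ y‖ₑ + ‖u₁ y‖ₑ * ‖fderiv ℝ u₂ y‖ₑ := by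
    intro y
    have hu1 : HasFDerivAt u₁ (fderiv ℝ u₁ y) y := u₁.differentiableAt.hasFDerivAt
    have hu2 : HasFDerivAt u₂ (fderiv ℝ u₂ y) y := u₂.differentiableAt.hasFDerivAt
    have hc : HasFDerivAt (fun y => (starRingEnd ℂ) (u₂ y))
      ((conjCLE : ℂ →L[ℝ] ℂ).comp (fderiv ℝ u₂ y)) y :=
      (conjCLE : ℂ →L[ℝ] ℂ).hasFDerivAt.comp y hu2
    have hm : HasFDerivAt (fun y => u₁ y * (starRingEnd ℂ) (u₂ y))
        (u₁ y • (conjCLE : ℂ →L[ℝ] ℂ).comp (fderiv ℝ u₂ y) +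
          (starRingEnd ℂ) (u₂ y) • fderiv ℝ u₁ y) y := hu1.mul hc
    have hfe : (φ : EuclideanSpace ℝ (Fin d) → ℂ) = fun y => u₁ y * (starRingEnd ℂ) (u₂ y) :=
      funext hφ
    have hcn : ‖(conjCLE : ℂ →L[ℝ] ℂ).comp (fderiv ℝ u₂ y)‖ ≤ ‖fderiv ℝ u₂ y‖ :=
      ContinuousLinearMap.opNorm_le_bound _ (norm_nonneg _) fun v => by
        simpa using (fderiv ℝ u₂ y).le_opNorm v
    rw [hfe, HasFDerivAt.fderiv hm]
    have hr : ‖u₁ y • (conjCLE : ℂ →L[ℝ] ℂ).comp (fderiv ℝ u₂ y) +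
        (starRingEnd ℂ) (u₂ y) • fderiv ℝ u₁ y‖ ≤
        ‖fderiv ℝ u₁ y‖ * ‖u₂ y‖ + ‖u₁ y‖ * ‖fderiv ℝ u₂ y‖ := by
      refine (norm_add_le _ _).trans ?_
      rw [norm_smul, norm_smul, RCLike.norm_conj, add_comm, mul_comm ‖u₂ y‖]
      gcongr
    have := ENNReal.ofReal_le_ofReal hr
    rw [ENNReal.ofReal_add (by positivity) (by positivity), ENNReal.ofReal_mul (by positivity),
      ENNReal.ofReal_mul (by positivity)] at this
    simpa only [ofReal_norm] using this
  have hG := riesz_hasFDerivAt hd hγ0 hγd φ x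
  have hu3 : HasFDerivAt u₃ (fderiv ℝ u₃ x) x := u₃.differentiableAt.hasFDerivAt
  have hT : HasFDerivAt (fun x => (∫ y, ((‖x - y‖ ^ (-γ) : ℝ) : ℂ) * φ y) * u₃ x)
      ((∫ y, ((‖x - y‖ ^ (-γ) : ℝ) : ℂ) * φ y) • fderiv ℝ u₃ x +
        u₃ x • ∫ z, ‖z‖ ^ (-γ) • fderiv ℝ φ (x - z)) x := hG.mul hu3
  have hTe : hartreeT d γ u₁ u₂ u₃ =
      fun x => (∫ y, ((‖x - y‖ ^ (-γ) : ℝ) : ℂ) * φ y) * u₃ x := by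
    ext x
    simp only [hartreeT, hφ]
  rw [hTe]
  refine ⟨hT.differentiableAt, ?_⟩
  rw [HasFDerivAt.fderiv hT]
  have hGx : ‖∫ y, ((‖x - y‖ ^ (-γ) : ℝ) : ℂ) * φ y‖ₑ ≤
      hlsI d γ (fun y => ‖u₁ y‖ₑ * ‖u₂ y‖ₑ) x := by
    have e : ∫ y, ((‖x - y‖ ^ (-γ) : ℝ) : ℂ) * φ y = ∫ z, ‖z‖ ^ (-γ) • φ (x - z) := by
      rw [← integral_sub_left_eq_self _ volume x]
      simp
    rw [e]
    refine (riesz_enorm_le hγ0 φ x).trans (hlsI_mono (fun y => ?_) x)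
    rw [hφ, enorm_mul, RCLike.enorm_conj]
  have hGd : ‖∫ z, ‖z‖ ^ (-γ) • fderiv ℝ φ (x - z)‖ₑ ≤
      hlsI d γ (fun y => ‖fderiv ℝ u₁ y‖ₑ * ‖u₂ y‖ₑ) x +
        hlsI d γ (fun y => ‖u₁ y‖ₑ * ‖fderiv ℝ u₂ y‖ₑ) x := by
    refine (riesz_enorm_le hγ0 (fun y => fderiv ℝ φ y) x).trans ?_
    rw [← hlsI_add]
    · exact hlsI_mono hφd x
    · have h1 : Measurable fun y => fderiv ℝ u₁ y := measurable_fderiv ℝ _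
      have h2 : Measurable u₂ := u₂.continuous.measurable
      fun_prop
  refine (enorm_add_le ((∫ y, ((‖x - y‖ ^ (-γ) : ℝ) : ℂ) * φ y) • fderiv ℝ u₃ x)
    (u₃ x • ∫ z, ‖z‖ ^ (-γ) • fderiv ℝ φ (x - z))).trans ?_
  rw [enorm_smul, enorm_smul, add_comm, ← add_mul, mul_comm ‖u₃ x‖ₑ]
  exact add_le_add (mul_le_mul_left hGd _) (mul_le_mul_left hGx _)

lemma fderiv_le_gradVec (d : ℕ) (u : EuclideanSpace ℝ (Fin d) → ℂ)
    (x : EuclideanSpace ℝ (Fin d)) : ‖fderiv ℝ u x‖ ≤ ‖gradVec d u x‖ := by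
  refine ContinuousLinearMap.opNorm_le_bound _ (norm_nonneg _) fun v => ?_
  have hv : v = ∑ j, v j • EuclideanSpace.single j (1 : ℝ) := by
    ext i
    simp [Finset.sum_apply, Pi.single_apply]
  have h1 : fderiv ℝ u x v = ∑ j, v j • fderiv ℝ u x (EuclideanSpace.single j 1) := by
    conv_lhs => rw [hv]
    simp only [map_sum, map_smul]
  rw [h1]
  calc _ ≤ ∑ j, ‖v j‖ * ‖fderiv ℝ u x (EuclideanSpace.single j 1)‖ := by
        refine (norm_sum_le _ _).trans (le_of_eq ?_)
        simp only [norm_smul]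
    _ ≤ √(∑ j, ‖v j‖ ^ 2) * √(∑ j, ‖fderiv ℝ u x (EuclideanSpace.single j 1)‖ ^ 2) :=
        Real.sum_mul_le_sqrt_mul_sqrt _ _ _
    _ = _ := by
        rw [EuclideanSpace.norm_eq, EuclideanSpace.norm_eq, mul_comm]
        rfl

lemma gradVec_le_fderiv (d : ℕ) (u : EuclideanSpace ℝ (Fin d) → ℂ)
    (x : EuclideanSpace ℝ (Fin d)) : ‖gradVec d u x‖ ≤ √d * ‖fderiv ℝ u x‖ := by
  rw [EuclideanSpace.norm_eq]
  have : ∑ j, ‖gradVec d u x j‖ ^ 2 ≤ ∑ _j : Fin d, ‖fderiv ℝ u x‖ ^ 2 := by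
    refine Finset.sum_le_sum fun j _ => ?_
    gcongr
    have := (fderiv ℝ u x).le_opNorm (EuclideanSpace.single j 1)
    simpa [gradVec] using this
  refine (Real.sqrt_le_sqrt this).trans (le_of_eq ?_)
  simp

lemma hls_trilinear (d : ℕ) (hd : 1 ≤ d) (γ : ℝ) (hγ0 : 0 < γ) (hγd : γ < d) (r r' : ℝ)
    (hr : r = 4 * d / (2 * d - γ)) (hr' : r' = 4 * d / (2 * d + γ)) :
    ∃ C : ℝ≥0∞, C ≠ ⊤ ∧ ∀ (f g h : EuclideanSpace ℝ (Fin d) → ℝ≥0∞),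
      Measurable f → Measurable g → Measurable h →
      (∫⁻ x, (hlsI d γ (fun y => f y * g y) x * h x) ^ r') ^ (1 / r') ≤
        C * ((∫⁻ x, f x ^ r) ^ (1 / r) * (∫⁻ x, g x ^ r) ^ (1 / r) *
          (∫⁻ x, h x ^ r) ^ (1 / r)) := by
  have hd0 : (0 : ℝ) < d := by exact_mod_cast hd
  have h2 : 0 < 2 * d - γ := by linarith
  obtain ⟨p, hp⟩ : ∃ p : ℝ, p = 2 * d / (2 * d - γ) := ⟨_, rfl⟩
  obtain ⟨q, hq⟩ : ∃ q : ℝ, q = 2 * d / γ := ⟨_, rfl⟩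
  have hpq : p.HolderConjugate q := by
    rw [Real.holderConjugate_iff]
    refine ⟨?_, ?_⟩
    · rw [hp, lt_div_iff₀ h2]; linarith
    · rw [hp, hq]; field_simp; ring
  obtain ⟨C, hC, hM⟩ := hls_main d hd γ hγ0 hγd p q hp hpq
  refine ⟨C, hC, fun f g h hf hg hh => ?_⟩
  have hm := measurable_hlsI d γ (f := fun y => f y * g y) (by fun_prop)
  have a1 := ENNReal.lintegral_Lp_mul_le_Lq_mul_Lr (p := r') (q := q) (r := r)
    (by rw [hr']; positivity)
    (by rw [hr', hq, div_lt_div_iff₀ (by positivity) (by positivity)]; nlinarith)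
    (by rw [hr, hr', hq]; field_simp; ring) volume hm.aemeasurable hh.aemeasurable
  have a2 := ENNReal.lintegral_Lp_mul_le_Lq_mul_Lr (p := p) (q := r) (r := r)
    (by rw [hp]; positivity)
    (by rw [hr, hp]; gcongr; norm_num)
    (by rw [hr, hp]; field_simp; ring) volume hf.aemeasurable hg.aemeasurable
  refine a1.trans ?_
  rw [← mul_assoc]
  refine mul_le_mul_left ((hM _ (by fun_prop)).trans ?_) _
  exact mul_le_mul_right a2 _

lemma eLpNorm_ofReal_eq {d : ℕ} {F : Type*} [NormedAddCommGroup F] {r : ℝ} (hr : 0 < r)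
    (f : EuclideanSpace ℝ (Fin d) → F) :
    eLpNorm f (ENNReal.ofReal r) volume = (∫⁻ x, ‖f x‖ₑ ^ r) ^ (1 / r) := by
  rw [eLpNorm_eq_lintegral_rpow_enorm_toReal (by simpa using hr) (by simp),
    ENNReal.toReal_ofReal hr.le]

/-- **Gradient estimate for the trilinear Hartree form.** For `d ≥ 1`, `0 < γ < d`,
`r = 4d/(2d-γ)` and `r'` its Hölder conjugate, there is `C = C(d,γ) > 0` such that for all
Schwartz `u₁,u₂,u₃`, the function `T(u₁,u₂,u₃)` is differentiable and
`‖∇T(u₁,u₂,u₃)‖_{L^{r'}} ≤ C ∑_{i} ‖∇u_i‖_{L^r} ∏_{j≠i} ‖u_j‖_{L^r}`. -/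
theorem hartreeT_gradient_estimate (d : ℕ) (hd : 1 ≤ d) (γ : ℝ) (hγ0 : 0 < γ)
    (hγd : γ < d) (r' : ℝ) (hconj : 1 / (4 * d / (2 * d - γ)) + 1 / r' = 1) :
    ∃ C > (0 : ℝ), ∀ u₁ u₂ u₃ : SchwartzMap (EuclideanSpace ℝ (Fin d)) ℂ,
      Differentiable ℝ (hartreeT d γ ⇑u₁ ⇑u₂ ⇑u₃) ∧
        eLpNorm (gradVec d (hartreeT d γ ⇑u₁ ⇑u₂ ⇑u₃)) (ENNReal.ofReal r') volume ≤
          ENNReal.ofReal C *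
            (eLpNorm (gradVec d ⇑u₁) (ENNReal.ofReal (4 * d / (2 * d - γ))) volume *
                eLpNorm (⇑u₂) (ENNReal.ofReal (4 * d / (2 * d - γ))) volume *
                eLpNorm (⇑u₃) (ENNReal.ofReal (4 * d / (2 * d - γ))) volume +
              eLpNorm (⇑u₁) (ENNReal.ofReal (4 * d / (2 * d - γ))) volume *
                eLpNorm (gradVec d ⇑u₂) (ENNReal.ofReal (4 * d / (2 * d - γ))) volume *
                eLpNorm (⇑u₃) (ENNReal.ofReal (4 * d / (2 * d - γ))) volume +
              eLpNorm (⇑u₁) (ENNReal.ofReal (4 * d / (2 * d - γ))) volume *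
                eLpNorm (⇑u₂) (ENNReal.ofReal (4 * d / (2 * d - γ))) volume *
                eLpNorm (gradVec d ⇑u₃) (ENNReal.ofReal (4 * d / (2 * d - γ))) volume) := by
  have hd0 : (0 : ℝ) < d := by exact_mod_cast hd
  have h2 : 0 < 2 * d - γ := by linarith
  obtain ⟨r, hr⟩ : ∃ r : ℝ, r = 4 * d / (2 * d - γ) := ⟨_, rfl⟩
  have hr' : r' = 4 * d / (2 * d + γ) := by
    have h1 : 1 / r' = (2 * d + γ) / (4 * d) := by
      have : 1 / r' = 1 - 1 / (4 * d / (2 * d - γ)) := by linarith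
      rw [this]; field_simp; ring
    rw [← one_div_one_div r', h1, one_div_div]
  rw [← hr]
  have hr0 : 0 < r := by rw [hr]; positivity
  have hr'0 : 0 < r' := by rw [hr']; positivity
  have hr'1 : 1 ≤ r' := by rw [hr', le_div_iff₀ (by positivity)]; linarith
  obtain ⟨C, hC, hT⟩ := hls_trilinear d hd γ hγ0 hγd r r' hr hr'
  obtain ⟨K, hK⟩ : ∃ K : ℝ≥0∞, K = ENNReal.ofReal √d := ⟨_, rfl⟩
  have hKt : K ≠ ⊤ := by rw [hK]; simp
  refine ⟨(K * C).toReal + 1, by positivity, fun u₁ u₂ u₃ =>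
    ⟨fun x => (hartreeT_deriv hd hγ0 hγd u₁ u₂ u₃ x).1, ?_⟩⟩
  have hKC : K * C ≤ ENNReal.ofReal ((K * C).toReal + 1) := by
    rw [ENNReal.ofReal_add (by positivity) (by norm_num),
      ENNReal.ofReal_toReal (ENNReal.mul_ne_top hKt hC)]
    exact le_self_add
  simp only [eLpNorm_ofReal_eq hr0, eLpNorm_ofReal_eq hr'0]
  have ma : ∀ u : SchwartzMap (EuclideanSpace ℝ (Fin d)) ℂ,
      Measurable fun y => ‖fderiv ℝ u y‖ₑ := fun u => (measurable_fderiv ℝ _).enorm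
  have mb : ∀ u : SchwartzMap (EuclideanSpace ℝ (Fin d)) ℂ,
      Measurable fun y => ‖u y‖ₑ := fun u => u.continuous.measurable.enorm
  have hag : ∀ u : SchwartzMap (EuclideanSpace ℝ (Fin d)) ℂ,
      (∫⁻ x, ‖fderiv ℝ u x‖ₑ ^ r) ^ (1 / r) ≤ (∫⁻ x, ‖gradVec d u x‖ₑ ^ r) ^ (1 / r) := by
    intro u
    gcongr with x
    rw [← ofReal_norm, ← ofReal_norm]
    exact ENNReal.ofReal_le_ofReal (fderiv_le_gradVec d u x)
  let G₁ : EuclideanSpace ℝ (Fin d) → ℝ≥0∞ := fun x =>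
    hlsI d γ (fun y => ‖fderiv ℝ u₁ y‖ₑ * ‖u₂ y‖ₑ) x * ‖u₃ x‖ₑ
  let G₂ : EuclideanSpace ℝ (Fin d) → ℝ≥0∞ := fun x =>
    hlsI d γ (fun y => ‖u₁ y‖ₑ * ‖fderiv ℝ u₂ y‖ₑ) x * ‖u₃ x‖ₑ
  let G₃ : EuclideanSpace ℝ (Fin d) → ℝ≥0∞ := fun x =>
    hlsI d γ (fun y => ‖u₁ y‖ₑ * ‖u₂ y‖ₑ) x * ‖fderiv ℝ u₃ x‖ₑ
  have mG₁ : Measurable G₁ := (measurable_hlsI d γ ((ma u₁).mul (mb u₂))).mul (mb u₃)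
  have mG₂ : Measurable G₂ := (measurable_hlsI d γ ((mb u₁).mul (ma u₂))).mul (mb u₃)
  have mG₃ : Measurable G₃ := (measurable_hlsI d γ ((mb u₁).mul (mb u₂))).mul (ma u₃)
  have hpt : ∀ x, ‖gradVec d (hartreeT d γ u₁ u₂ u₃) x‖ₑ ≤ K * (G₁ + G₂ + G₃) x := by
    intro x
    have h1 := ENNReal.ofReal_le_ofReal (gradVec_le_fderiv d (hartreeT d γ u₁ u₂ u₃) x)
    rw [ENNReal.ofReal_mul (by positivity), ofReal_norm, ofReal_norm, ← hK] at h1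
    exact h1.trans (mul_le_mul_right (hartreeT_deriv hd hγ0 hγd u₁ u₂ u₃ x).2 _)
  calc _ ≤ (∫⁻ x, (K * (G₁ + G₂ + G₃) x) ^ r') ^ (1 / r') := by
        gcongr with x
        exact hpt x
    _ = K * (∫⁻ x, ((G₁ + G₂ + G₃) x) ^ r') ^ (1 / r') := by
        simp_rw [ENNReal.mul_rpow_of_nonneg _ _ hr'0.le]
        rw [lintegral_const_mul _ (by fun_prop), ENNReal.mul_rpow_of_nonneg _ _ (by positivity),
          ← ENNReal.rpow_mul, mul_one_div_cancel hr'0.ne', ENNReal.rpow_one]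
    _ ≤ K * ((∫⁻ x, (G₁ x) ^ r') ^ (1 / r') + (∫⁻ x, (G₂ x) ^ r') ^ (1 / r') +
          (∫⁻ x, (G₃ x) ^ r') ^ (1 / r')) := by
        refine mul_le_mul_right ?_ _
        refine (ENNReal.lintegral_Lp_add_le (mG₁.add mG₂).aemeasurable mG₃.aemeasurable
          hr'1).trans ?_
        refine add_le_add_left ?_ _
        exact ENNReal.lintegral_Lp_add_le mG₁.aemeasurable mG₂.aemeasurable hr'1
    _ ≤ K * (C * _ + C * _ + C * _) := by
        refine mul_le_mul_right (add_le_add (add_le_add ?_ ?_) ?_) _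
        · exact hT _ _ _ (ma u₁) (mb u₂) (mb u₃)
        · exact hT _ _ _ (mb u₁) (ma u₂) (mb u₃)
        · exact hT _ _ _ (mb u₁) (mb u₂) (ma u₃)
    _ ≤ _ := by
        rw [← mul_add, ← mul_add, ← mul_assoc]
        refine mul_le_mul' hKC ?_
        have g1 := hag u₁
        have g2 := hag u₂
        have g3 := hag u₃
        gcongr
end
end
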